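/- Let σ ≤ 0, d > 0, and θ be fixed real numbers, fix α ∈ (0,1] and constants C_2 > C_1 > 1, let c > 0 depend on d, θ, and set H = c·(log(MN))^{1+α} and D = e^{2πi/8}·d^{1/2−σ}. Then for all integers N, M ≥ 2 with C_1·N ≤ M ≤ C_2·N and every integer X with 2 ≤ X ≤ min(M, N): Σ_{n=1}^N ζ(σ + 2πidn)·e^{2πiθn}/n^{1−σ} = D·Σ_{m=1}^M (1/m^{1−σ}) Σ_{h ∈ ℤ, |h| ≤ H} ∫_X^N e^{2πi(F_m(u) − hu)}/u^{1/2} du + O(1 + X^{1/2}·log H + 𝟙(σ = 0)·((log N)^{1−α} + X^{1/2}·(log X)^{2/3}·log H)), where the implied constant depends only on α, σ, d, θ, C_1, C_2, c. -/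

import Mathlib

/-- `Fm d θ m u = d·u·log(e·m/(d·u)) + θ·u`. -/
noncomputable def Fm (d θ : ℝ) (m : ℕ) (u : ℝ) : ℝ :=
  d * u * Real.log (Real.exp 1 * m / (d * u)) + θ * u

section Helpers
open MeasureTheory intervalIntegral Set


noncomputable def ee (x : ℝ) : ℂ := Complex.exp (2 * (Real.pi : ℂ) * Complex.I * (x : ℂ))

lemma ee_norm (x : ℝ) : ‖ee x‖ = 1 := by
  unfold ee
  rw [show (2 * (Real.pi : ℂ) * Complex.I * (x : ℂ)) = ((2 * Real.pi * x : ℝ) : ℂ) * Complex.I by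
    push_cast; ring]
  exact Complex.norm_exp_ofReal_mul_I _

lemma ee_add (x y : ℝ) : ee (x + y) = ee x * ee y := by
  unfold ee
  rw [← Complex.exp_add]; congr 1; push_cast; ring

lemma ee_int (n : ℤ) : ee n = 1 := by
  unfold ee
  rw [Complex.exp_eq_one_iff]
  exact ⟨n, by push_cast; ring⟩

lemma ee_cont : Continuous ee := by unfold ee; fun_prop

lemma ee_deriv {G : ℝ → ℝ} {g u : ℝ} (h : HasDerivAt G g u) :
    HasDerivAt (fun u => ee (G u)) (2 * (Real.pi : ℂ) * Complex.I * (g : ℂ) * ee (G u)) u := by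
  unfold ee
  have h1 := (h.ofReal_comp.const_mul (2 * (Real.pi : ℂ) * Complex.I)).cexp
  convert! h1 using 1
  ring

lemma two_pi_I_ne : (2 * (Real.pi : ℂ) * Complex.I) ≠ 0 := by
  simp [Real.pi_ne_zero]

lemma two_pi_I_norm : ‖(2 * (Real.pi : ℂ) * Complex.I)‖ = 2 * Real.pi := by
  simp [abs_of_pos Real.pi_pos]

lemma osc_ibp {a b : ℝ} (hab : a ≤ b) {w w1 G G1 G2 : ℝ → ℝ}
    (hw : ∀ u ∈ Icc a b, HasDerivAt w (w1 u) u) (hG : ∀ u ∈ Icc a b, HasDerivAt G (G1 u) u)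
    (hG1 : ∀ u ∈ Icc a b, HasDerivAt G1 (G2 u) u) (h0 : ∀ u ∈ Icc a b, G1 u ≠ 0)
    (cw1 : ContinuousOn w1 (Icc a b)) (cG2 : ContinuousOn G2 (Icc a b)) :
    ∫ u in a..b, (w u : ℂ) * ee (G u) = (1 / (2 * (Real.pi : ℂ) * Complex.I)) *
      (((w b / G1 b : ℝ) : ℂ) * ee (G b) - ((w a / G1 a : ℝ) : ℂ) * ee (G a)
        - ∫ u in a..b, (((w1 u * G1 u - w u * G2 u) / (G1 u) ^ 2 : ℝ) : ℂ) * ee (G u)) := by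
  have cw : ContinuousOn w (Icc a b) := fun u hu => (hw u hu).continuousAt.continuousWithinAt
  have cG : ContinuousOn G (Icc a b) := fun u hu => (hG u hu).continuousAt.continuousWithinAt
  have cG1 : ContinuousOn G1 (Icc a b) := fun u hu => (hG1 u hu).continuousAt.continuousWithinAt
  have hI : uIcc a b = Icc a b := uIcc_of_le hab
  have key := intervalIntegral.integral_mul_deriv_eq_deriv_mul (a := a) (b := b)
    (u := fun u => ((w u / G1 u : ℝ) : ℂ)) (v := fun u => ee (G u))
    (u' := fun u => (((w1 u * G1 u - w u * G2 u) / (G1 u) ^ 2 : ℝ) : ℂ))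
    (v' := fun u => 2 * (Real.pi : ℂ) * Complex.I * (G1 u : ℂ) * ee (G u))
    (by
      rw [hI]; intro u hu
      exact ((hw u hu).div (hG1 u hu) (h0 u hu)).ofReal_comp)
    (by rw [hI]; intro u hu; exact ee_deriv (hG u hu))
    (by
      apply ContinuousOn.intervalIntegrable
      rw [hI]
      apply Complex.continuous_ofReal.comp_continuousOn
      exact ((cw1.mul cG1).sub (cw.mul cG2)).div (cG1.pow 2) (fun u hu => pow_ne_zero 2 (h0 u hu)))
    (by
      apply ContinuousOn.intervalIntegrable
      rw [hI]
      exact (continuousOn_const.mul (Complex.continuous_ofReal.comp_continuousOn cG1)).mul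
        (ee_cont.comp_continuousOn cG))
  rw [← key]
  have : ∫ u in a..b, ((w u / G1 u : ℝ) : ℂ) * (2 * (Real.pi : ℂ) * Complex.I * (G1 u : ℂ) * ee (G u))
      = ∫ u in a..b, (2 * (Real.pi : ℂ) * Complex.I) * ((w u : ℂ) * ee (G u)) := by
    apply intervalIntegral.integral_congr
    intro u hu
    rw [hI] at hu
    have := h0 u hu
    have h' : (G1 u : ℂ) ≠ 0 := by exact_mod_cast this
    push_cast
    field_simp
  rw [this, intervalIntegral.integral_const_mul, ← mul_assoc, one_div,
    inv_mul_cancel₀ two_pi_I_ne, one_mul]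

lemma osc_first {a b μ : ℝ} (hab : a ≤ b) (hμ : 0 < μ) {w w1 G G1 G2 : ℝ → ℝ}
    (hw : ∀ u ∈ Icc a b, HasDerivAt w (w1 u) u) (hG : ∀ u ∈ Icc a b, HasDerivAt G (G1 u) u)
    (hG1 : ∀ u ∈ Icc a b, HasDerivAt G1 (G2 u) u) (h0 : ∀ u ∈ Icc a b, μ ≤ |G1 u|)
    (cw1 : ContinuousOn w1 (Icc a b)) (cG2 : ContinuousOn G2 (Icc a b))
    (wpos : ∀ u ∈ Icc a b, 0 ≤ w u) (wa : ∀ u ∈ Icc a b, w u ≤ w a)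
    (w1n : ∀ u ∈ Icc a b, w1 u ≤ 0) (G2n : ∀ u ∈ Icc a b, G2 u ≤ 0) :
    ‖∫ u in a..b, (w u : ℂ) * ee (G u)‖ ≤ 5 * (w a / μ) := by
  have h0' : ∀ u ∈ Icc a b, G1 u ≠ 0 := fun u hu h => by
    have := h0 u hu; rw [h] at this; simp at this; linarith
  have cw : ContinuousOn w (Icc a b) := fun u hu => (hw u hu).continuousAt.continuousWithinAt
  have cG1 : ContinuousOn G1 (Icc a b) := fun u hu => (hG1 u hu).continuousAt.continuousWithinAt
  have hI : uIcc a b = Icc a b := uIcc_of_le hab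
  have ha : a ∈ Icc a b := ⟨le_rfl, hab⟩
  have hb : b ∈ Icc a b := ⟨hab, le_rfl⟩
  rw [osc_ibp hab hw hG hG1 h0' cw1 cG2]
  have hbd : ∀ u ∈ Icc a b, |w u / G1 u| ≤ w a / μ := by
    intro u hu
    rw [abs_div, abs_of_nonneg (wpos u hu)]
    exact div_le_div₀ (wpos a ha) (wa u hu) hμ (h0 u hu)
  -- integral bound
  have i1 : ∫ u in a..b, w1 u = w b - w a :=
    intervalIntegral.integral_eq_sub_of_hasDerivAt (by rw [hI]; exact hw)
      (ContinuousOn.intervalIntegrable (by rw [hI]; exact cw1))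
  have cq : ContinuousOn (fun u => -G2 u / (G1 u) ^ 2) (Icc a b) :=
    cG2.neg.div (cG1.pow 2) (fun u hu => pow_ne_zero 2 (h0' u hu))
  have i2 : ∫ u in a..b, -G2 u / (G1 u) ^ 2 = (G1 b)⁻¹ - (G1 a)⁻¹ :=
    intervalIntegral.integral_eq_sub_of_hasDerivAt
      (by rw [hI]; intro u hu; exact (hG1 u hu).inv (h0' u hu))
      (ContinuousOn.intervalIntegrable (by rw [hI]; exact cq))
  have hinv : ∀ u ∈ Icc a b, |(G1 u)⁻¹| ≤ 1 / μ := by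
    intro u hu
    rw [abs_inv, one_div]
    exact inv_anti₀ hμ (h0 u hu)
  have hint : ‖∫ u in a..b, (((w1 u * G1 u - w u * G2 u) / (G1 u) ^ 2 : ℝ) : ℂ) * ee (G u)‖
      ≤ ∫ u in a..b, ((1 / μ) * (- w1 u) + w a * (-G2 u / (G1 u) ^ 2)) := by
    apply intervalIntegral.norm_integral_le_of_norm_le hab
    · refine Filter.Eventually.of_forall ?_
      intro u hu'
      have hu : u ∈ Icc a b := ⟨hu'.1.le, hu'.2⟩
      rw [norm_mul, ee_norm, mul_one, Complex.norm_real, Real.norm_eq_abs]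
      have e1 : (w1 u * G1 u - w u * G2 u) / (G1 u) ^ 2
          = w1 u * (G1 u)⁻¹ + w u * (-G2 u / (G1 u) ^ 2) := by
        have := h0' u hu
        field_simp
        ring
      rw [e1]
      refine (abs_add_le _ _).trans ?_
      have q0 : 0 ≤ -G2 u / (G1 u) ^ 2 := div_nonneg (by linarith [G2n u hu]) (sq_nonneg _)
      gcongr
      · rw [abs_mul, abs_of_nonpos (w1n u hu), mul_comm]
        exact mul_le_mul_of_nonneg_right (hinv u hu) (by linarith [w1n u hu])
      · rw [abs_mul, abs_of_nonneg (wpos u hu), abs_of_nonneg q0]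
        exact mul_le_mul_of_nonneg_right (wa u hu) q0
    · apply ContinuousOn.intervalIntegrable
      rw [hI]
      exact (continuousOn_const.mul cw1.neg).add (continuousOn_const.mul cq)
  have hint2 : ∫ u in a..b, ((1 / μ) * (- w1 u) + w a * (-G2 u / (G1 u) ^ 2)) ≤ 3 * (w a / μ) := by
    rw [intervalIntegral.integral_add, intervalIntegral.integral_const_mul,
      intervalIntegral.integral_const_mul, intervalIntegral.integral_neg, i1, i2]
    · have q1 : (1 / μ) * -(w b - w a) ≤ w a / μ := by
        rw [div_eq_mul_one_div (w a) μ, mul_comm]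
        exact mul_le_mul_of_nonneg_right (by linarith [wpos b hb]) (by positivity)
      have q2 : w a * ((G1 b)⁻¹ - (G1 a)⁻¹) ≤ w a * (2 * (1 / μ)) := by
        apply mul_le_mul_of_nonneg_left _ (wpos a ha)
        have := abs_le.1 (hinv a ha)
        have := abs_le.1 (hinv b hb)
        linarith
      have : w a * (2 * (1 / μ)) = 2 * (w a / μ) := by ring
      linarith
    · apply ContinuousOn.intervalIntegrable
      rw [hI]; exact (continuousOn_const.mul cw1.neg)
    · apply ContinuousOn.intervalIntegrable
      rw [hI]; exact (continuousOn_const.mul cq)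
  have hnn : 0 ≤ w a / μ := div_nonneg (wpos a ha) hμ.le
  rw [norm_mul, norm_div, two_pi_I_norm, norm_one]
  have hpi : 1 / (2 * Real.pi) ≤ 1 := by
    rw [div_le_one (by positivity)]; linarith [Real.pi_gt_three]
  refine (mul_le_of_le_one_left (norm_nonneg _) hpi).trans ?_
  refine (norm_sub_le _ _).trans ?_
  have t1 : ‖((w b / G1 b : ℝ) : ℂ) * ee (G b) - ((w a / G1 a : ℝ) : ℂ) * ee (G a)‖ ≤ 2 * (w a / μ) := by
    refine (norm_sub_le _ _).trans ?_
    rw [norm_mul, norm_mul, ee_norm, ee_norm, mul_one, mul_one, Complex.norm_real, Complex.norm_real,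
      Real.norm_eq_abs, Real.norm_eq_abs]
    linarith [hbd a ha, hbd b hb]
  linarith

lemma log_lower {u u0 Δ b : ℝ} (hu : 0 < u) (hub : u ≤ b) (hu0 : 0 < u0) (hb : 1 ≤ b)
    (hΔ : Δ = Real.sqrt b) (h : u + Δ ≤ u0 ∨ u0 + Δ ≤ u) :
    1 / (2 * Real.sqrt b) ≤ |Real.log u0 - Real.log u| := by
  have hs1 : 1 ≤ Real.sqrt b := Real.one_le_sqrt.2 hb
  have hss : Real.sqrt b * Real.sqrt b = b := Real.mul_self_sqrt (by linarith)
  subst hΔ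
  rcases h with h | h
  · have h1 : 1 - (u0 / u)⁻¹ ≤ Real.log (u0 / u) := Real.one_sub_inv_le_log_of_pos (by positivity)
    rw [Real.log_div hu0.ne' hu.ne'] at h1
    refine le_trans ?_ (h1.trans (le_abs_self _))
    rw [inv_div, le_sub_iff_add_le, div_add_div _ _ (by positivity) (by positivity),
      div_le_one (by positivity)]
    nlinarith
  · have h1 : 1 - (u / u0)⁻¹ ≤ Real.log (u / u0) := Real.one_sub_inv_le_log_of_pos (by positivity)
    rw [Real.log_div hu.ne' hu0.ne'] at h1
    rw [abs_sub_comm]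
    refine le_trans ?_ (h1.trans (le_abs_self _))
    rw [inv_div, le_sub_iff_add_le, div_add_div _ _ (by positivity) (by positivity),
      div_le_one (by positivity)]
    nlinarith

lemma rpow_hasDeriv (κ u : ℝ) (hu : 0 < u) :
    HasDerivAt (fun u : ℝ => u ^ (-κ)) (-κ * u ^ (-κ - 1)) u :=
  Real.hasDerivAt_rpow_const (Or.inl hu.ne')

lemma osc_second {d : ℝ} (hd : 0 < d) {a b B : ℝ} (ha : 1 ≤ a) (hab : a ≤ b) {G : ℝ → ℝ}
    (hG : ∀ u : ℝ, 0 < u → HasDerivAt G (d * (B - Real.log u)) u) :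
    ‖∫ u in a..b, ((u ^ (-(1/2 : ℝ)) : ℝ) : ℂ) * ee (G u)‖ ≤ (2 + 20 / d) * Real.sqrt (b / a) := by
  have hb : 1 ≤ b := ha.trans hab
  have ha0 : 0 < a := by linarith
  set Δ := Real.sqrt b with hΔ
  have hΔ1 : 1 ≤ Δ := Real.one_le_sqrt.2 hb
  set u0 := Real.exp B with hu0
  have hu0p : 0 < u0 := Real.exp_pos _
  have hlu0 : Real.log u0 = B := Real.log_exp _
  set p := max a (min b (u0 - Δ)) with hp
  set q := max a (min b (u0 + Δ)) with hq
  have hap : a ≤ p := le_max_left _ _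
  have hpb : p ≤ b := max_le hab (min_le_left _ _)
  have hqb : q ≤ b := max_le hab (min_le_left _ _)
  have hpq : p ≤ q := max_le_max_left _ (min_le_min_left _ (by linarith))
  have hqp : q - p ≤ 2 * Δ := by
    rw [hp, hq]
    rcases le_total b (u0 - Δ) with h1 | h1 <;> rcases le_total b (u0 + Δ) with h2 | h2 <;>
    simp only [min_eq_left h1, min_eq_right h1, min_eq_left h2, min_eq_right h2]
    · linarith
    · linarith
    · rcases le_total a b with h3 | h3 <;> rcases le_total a (u0 - Δ) with h4 | h4 <;>
      simp only [max_eq_left h3, max_eq_right h3, max_eq_left h4, max_eq_right h4] <;> linarith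
    · rcases le_total a (u0 + Δ) with h3 | h3 <;> rcases le_total a (u0 - Δ) with h4 | h4 <;>
      simp only [max_eq_left h3, max_eq_right h3, max_eq_left h4, max_eq_right h4] <;> linarith
  set f : ℝ → ℂ := fun u => ((u ^ (-(1/2 : ℝ)) : ℝ) : ℂ) * ee (G u) with hf
  have cf : ContinuousOn f (Ioi 0) := by
    apply ContinuousOn.mul
    · apply Complex.continuous_ofReal.comp_continuousOn
      exact fun u hu => (rpow_hasDeriv (1/2) u hu).continuousAt.continuousWithinAt
    · exact ee_cont.comp_continuousOn (fun u hu => (hG u hu).continuousAt.continuousWithinAt)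
  have fi : ∀ x y, a ≤ x → x ≤ y → IntervalIntegrable f volume x y := by
    intro x y hx hxy
    apply ContinuousOn.intervalIntegrable
    rw [uIcc_of_le hxy]
    exact cf.mono (fun u hu => by simp only [mem_Ioi]; linarith [hu.1])
  have wanti : ∀ x u : ℝ, a ≤ x → x ≤ u → u ^ (-(1/2 : ℝ)) ≤ x ^ (-(1/2 : ℝ)) := by
    intro x u hx hxu
    exact Real.rpow_le_rpow_of_nonpos (by linarith) hxu (by norm_num)
  have hfirst : ∀ x y : ℝ, a ≤ x → x ≤ y → y ≤ b →
      (∀ u ∈ Icc x y, u + Δ ≤ u0 ∨ u0 + Δ ≤ u) →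
      ‖∫ u in x..y, f u‖ ≤ 10 / d * (Δ * a ^ (-(1/2 : ℝ))) := by
    intro x y hx hxy hyb hcond
    have hpos : ∀ u ∈ Icc x y, 0 < u := fun u hu => by linarith [hu.1]
    have h := osc_first (a := x) (b := y) (μ := d * (1 / (2 * Δ))) hxy (by positivity)
      (w := fun u => u ^ (-(1/2 : ℝ))) (w1 := fun u => -(1/2 : ℝ) * u ^ (-(1/2 : ℝ) - 1)) (G := G)
      (G1 := fun u => d * (B - Real.log u)) (G2 := fun u => d * (0 - u⁻¹))
      (fun u hu => rpow_hasDeriv (1/2) u (hpos u hu)) (fun u hu => hG u (hpos u hu))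
      (fun u hu => ((hasDerivAt_const u B).sub (Real.hasDerivAt_log (hpos u hu).ne')).const_mul d)
      (fun u hu => by
        rw [abs_mul, abs_of_pos hd, ← hlu0]
        exact mul_le_mul_of_nonneg_left
          (log_lower (hpos u hu) (hu.2.trans hyb) hu0p hb hΔ (hcond u hu)) hd.le)
      (by
        apply continuousOn_const.mul
        intro u hu
        exact (Real.continuousAt_rpow_const _ _ (Or.inl (hpos u hu).ne')).continuousWithinAt)
      (by
        apply continuousOn_const.mul
        apply continuousOn_const.sub
        exact continuousOn_inv₀.mono (fun u hu => (hpos u hu).ne'))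
      (fun u hu => by have := hpos u hu; positivity)
      (fun u hu => wanti x u hx hu.1)
      (fun u hu => by have := hpos u hu; have : 0 < u ^ (-(1/2 : ℝ) - 1) := by positivity
                      linarith)
      (fun u hu => by
        have : 0 < u⁻¹ := inv_pos.2 (hpos u hu)
        nlinarith)
    refine h.trans ?_
    have h2 := wanti a x le_rfl hx
    have : 5 * (x ^ (-(1/2 : ℝ)) / (d * (1 / (2 * Δ)))) = 10 / d * (Δ * x ^ (-(1/2 : ℝ))) := by
      field_simp; ring
    rw [this]
    gcongr
  have e : ∫ u in a..b, f u = (∫ u in a..p, f u) + (∫ u in p..q, f u) + ∫ u in q..b, f u := by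
    rw [integral_add_adjacent_intervals (fi a p le_rfl hap) (fi p q hap hpq),
      integral_add_adjacent_intervals (fi a q le_rfl (hap.trans hpq)) (fi q b (hap.trans hpq) hqb)]
  have K1 : ‖∫ u in a..p, f u‖ ≤ 10 / d * (Δ * a ^ (-(1/2 : ℝ))) := by
    rcases le_total (min b (u0 - Δ)) a with h | h
    · have : p = a := max_eq_left h
      rw [this, integral_same, norm_zero]; positivity
    · have hp' : p ≤ u0 - Δ := by rw [hp, max_eq_right h]; exact min_le_right _ _
      exact hfirst a p le_rfl hap hpb (fun u hu => Or.inl (by linarith [hu.2]))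
  have K3 : ‖∫ u in q..b, f u‖ ≤ 10 / d * (Δ * a ^ (-(1/2 : ℝ))) := by
    rcases le_total b (u0 + Δ) with h | h
    · have : q = b := by rw [hq, min_eq_left h, max_eq_right hab]
      rw [this, integral_same, norm_zero]; positivity
    · have hp' : u0 + Δ ≤ q := by rw [hq, min_eq_right h]; exact le_max_right _ _
      exact hfirst q b (hap.trans hpq) hqb le_rfl (fun u hu => Or.inr (by linarith [hu.1]))
  have K2 : ‖∫ u in p..q, f u‖ ≤ 2 * (Δ * a ^ (-(1/2 : ℝ))) := by
    have := intervalIntegral.norm_integral_le_of_norm_le_const (a := p) (b := q) (f := f)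
      (C := a ^ (-(1/2 : ℝ))) (by
        intro u hu
        rw [uIoc_of_le hpq] at hu
        have hu1 : a ≤ u := hap.trans hu.1.le
        simp only [hf]
        rw [norm_mul, ee_norm, mul_one, Complex.norm_real, Real.norm_eq_abs,
          abs_of_nonneg (by have : 0 < u := by linarith
                            positivity)]
        exact wanti a u le_rfl hu1)
    rw [abs_of_nonneg (by linarith)] at this
    refine this.trans ?_
    have : 0 ≤ a ^ (-(1/2 : ℝ)) := by positivity
    nlinarith
  have hval : Δ * a ^ (-(1/2 : ℝ)) = Real.sqrt (b / a) := by
    rw [Real.rpow_neg ha0.le, ← Real.sqrt_eq_rpow, Real.sqrt_div (by linarith), div_eq_mul_inv]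
  rw [← hval, e]
  refine (norm_add₃_le).trans ?_
  have : (2 + 20 / d) * (Δ * a ^ (-(1/2 : ℝ))) = 10 / d * (Δ * a ^ (-(1/2 : ℝ))) +
    2 * (Δ * a ^ (-(1/2 : ℝ))) + 10 / d * (Δ * a ^ (-(1/2 : ℝ))) := by ring
  linarith


lemma osc_two {a b η W E : ℝ} (ha : 1 ≤ a) (hab : a ≤ b) (hη : 1 ≤ η) (hE : 1 ≤ E) (hW : 0 ≤ W)
    {w w1 w2 G G1 G2 G3 : ℝ → ℝ}
    (hw : ∀ u ∈ Icc a b, HasDerivAt w (w1 u) u) (hw1 : ∀ u ∈ Icc a b, HasDerivAt w1 (w2 u) u)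
    (hG : ∀ u ∈ Icc a b, HasDerivAt G (G1 u) u)
    (hG1 : ∀ u ∈ Icc a b, HasDerivAt G1 (G2 u) u) (hG2 : ∀ u ∈ Icc a b, HasDerivAt G2 (G3 u) u)
    (h0 : ∀ u ∈ Icc a b, η / 2 ≤ |G1 u|)
    (cw2 : ContinuousOn w2 (Icc a b)) (cG3 : ContinuousOn G3 (Icc a b))
    (bw : ∀ u ∈ Icc a b, |w u| ≤ W) (bw1 : ∀ u ∈ Icc a b, |w1 u| ≤ W * E / u)
    (bw2 : ∀ u ∈ Icc a b, |w2 u| ≤ W * E / u ^ 2)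
    (bG2 : ∀ u ∈ Icc a b, |G2 u| ≤ E / u) (bG3 : ∀ u ∈ Icc a b, |G3 u| ≤ E / u ^ 2) :
    ‖(∫ u in a..b, (w u : ℂ) * ee (G u)) - (1 / (2 * (Real.pi : ℂ) * Complex.I)) *
      (((w b / G1 b : ℝ) : ℂ) * ee (G b) - ((w a / G1 a : ℝ) : ℂ) * ee (G a))‖
      ≤ 108 * (W * E ^ 2 / η ^ 2) := by
  have hI : uIcc a b = Icc a b := uIcc_of_le hab
  have haI : a ∈ Icc a b := ⟨le_rfl, hab⟩
  have hbI : b ∈ Icc a b := ⟨hab, le_rfl⟩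
  have h0' : ∀ u ∈ Icc a b, G1 u ≠ 0 := fun u hu h => by
    have := h0 u hu; rw [h] at this; simp at this; linarith
  have cw : ContinuousOn w (Icc a b) := fun u hu => (hw u hu).continuousAt.continuousWithinAt
  have cw1 : ContinuousOn w1 (Icc a b) := fun u hu => (hw1 u hu).continuousAt.continuousWithinAt
  have cG1 : ContinuousOn G1 (Icc a b) := fun u hu => (hG1 u hu).continuousAt.continuousWithinAt
  have cG2 : ContinuousOn G2 (Icc a b) := fun u hu => (hG2 u hu).continuousAt.continuousWithinAt
  set v : ℝ → ℝ := fun u => (w1 u * G1 u - w u * G2 u) / (G1 u) ^ 2 with hv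
  set v1 : ℝ → ℝ := fun u => (((w2 u * G1 u + w1 u * G2 u) - (w1 u * G2 u + w u * G3 u)) * (G1 u) ^ 2
     - (w1 u * G1 u - w u * G2 u) * (2 * G1 u * G2 u)) / ((G1 u) ^ 2) ^ 2 with hv1
  have hvd : ∀ u ∈ Icc a b, HasDerivAt v (v1 u) u := by
    intro u hu
    have := (((hw1 u hu).mul (hG1 u hu)).sub ((hw u hu).mul (hG2 u hu))).div ((hG1 u hu).pow 2)
      (pow_ne_zero 2 (h0' u hu))
    convert! this using 1
    simp only [hv1, Pi.pow_apply, Pi.mul_apply, Pi.sub_apply]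
    norm_num
  have cv1 : ContinuousOn v1 (Icc a b) :=
    (((((cw2.mul cG1).add (cw1.mul cG2)).sub ((cw1.mul cG2).add (cw.mul cG3))).mul (cG1.pow 2)).sub
      (((cw1.mul cG1).sub (cw.mul cG2)).mul ((continuousOn_const.mul cG1).mul cG2))).div
      ((cG1.pow 2).pow 2) (fun u hu => pow_ne_zero 2 (pow_ne_zero 2 (h0' u hu)))
  have cv : ContinuousOn v (Icc a b) := fun u hu => (hvd u hu).continuousAt.continuousWithinAt
  have e1 := osc_ibp hab hw hG hG1 h0' cw1 cG2
  have e2 := osc_ibp hab hvd hG hG1 h0' cv1 cG2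
  -- pointwise bounds
  have hp : ∀ u ∈ Icc a b, |(G1 u)⁻¹| ≤ 2 / η := by
    intro u hu
    rw [abs_inv, show 2 / η = (η / 2)⁻¹ by rw [inv_div]]
    exact inv_anti₀ (by linarith) (h0 u hu)
  have hη2 : 2 / η ≤ 2 := by rw [div_le_iff₀ (by linarith)]; linarith
  have bv : ∀ u ∈ Icc a b, |v u| ≤ 3 * (2 / η) * (W * E / u) := by
    intro u hu
    have hu0 : 0 < u := by linarith [hu.1]
    have e : v u = w1 u * (G1 u)⁻¹ - w u * G2 u * ((G1 u)⁻¹ * (G1 u)⁻¹) := by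
      have := h0' u hu
      simp only [hv]; field_simp
    set p := (G1 u)⁻¹
    have hpu := hp u hu
    have hp2 : |p| ≤ 2 := hpu.trans hη2
    rw [e]
    calc |w1 u * p - w u * G2 u * (p * p)| ≤ |w1 u * p| + |w u * G2 u * (p * p)| := abs_sub _ _
      _ = |w1 u| * |p| + |w u| * |G2 u| * (|p| * |p|) := by simp only [abs_mul]
      _ ≤ (W * E / u) * (2 / η) + W * (E / u) * (2 * (2 / η)) := by
          gcongr
          · exact bw1 u hu
          · exact bw u hu
          · exact bG2 u hu
      _ = _ := by ring
  have bv1 : ∀ u ∈ Icc a b, |v1 u| ≤ 15 * (2 / η) * (W * E ^ 2 / u ^ 2) := by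
    intro u hu
    have hu0 : 0 < u := by linarith [hu.1]
    have e : v1 u = w2 u * (G1 u)⁻¹ - w u * G3 u * ((G1 u)⁻¹ * (G1 u)⁻¹)
        - 2 * (w1 u * G2 u * ((G1 u)⁻¹ * (G1 u)⁻¹))
        + 2 * (w u * (G2 u * G2 u) * ((G1 u)⁻¹ * ((G1 u)⁻¹ * (G1 u)⁻¹))) := by
      have := h0' u hu
      simp only [hv1]; field_simp; ring
    set p := (G1 u)⁻¹
    have hpu := hp u hu
    have hp2 : |p| ≤ 2 := hpu.trans hη2
    rw [e]
    have hEE : W * E / u ^ 2 ≤ W * E ^ 2 / u ^ 2 := by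
      gcongr; nlinarith
    calc _ ≤ |w2 u * p| + |w u * G3 u * (p * p)| + |2 * (w1 u * G2 u * (p * p))|
          + |2 * (w u * (G2 u * G2 u) * (p * (p * p)))| := by
          refine (abs_add_le _ _).trans ?_
          gcongr
          refine (abs_sub _ _).trans ?_
          gcongr
          exact abs_sub _ _
      _ = |w2 u| * |p| + |w u| * |G3 u| * (|p| * |p|) + 2 * (|w1 u| * |G2 u| * (|p| * |p|))
          + 2 * (|w u| * (|G2 u| * |G2 u|) * (|p| * (|p| * |p|))) := by
          simp only [abs_mul, abs_two]
      _ ≤ (W * E / u ^ 2) * (2 / η) + W * (E / u ^ 2) * (2 * (2 / η))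
          + 2 * ((W * E / u) * (E / u) * (2 * (2 / η)))
          + 2 * (W * ((E / u) * (E / u)) * (2 * (2 * (2 / η)))) := by
          gcongr
          · exact bw2 u hu
          · exact bw u hu
          · exact bG3 u hu
          · exact bw1 u hu
          · exact bG2 u hu
          · exact bw u hu
          · exact bG2 u hu
          · exact bG2 u hu
      _ = 3 * (2 / η) * (W * E / u ^ 2) + 12 * (2 / η) * (W * E ^ 2 / u ^ 2) := by ring
      _ ≤ 3 * (2 / η) * (W * E ^ 2 / u ^ 2) + 12 * (2 / η) * (W * E ^ 2 / u ^ 2) := by gcongr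
      _ = _ := by ring
  have bq : ∀ u ∈ Icc a b, |(v1 u * G1 u - v u * G2 u) / (G1 u) ^ 2|
      ≤ 84 * (W * E ^ 2 / η ^ 2) * (1 / u ^ 2) := by
    intro u hu
    have hu0 : 0 < u := by linarith [hu.1]
    have e : (v1 u * G1 u - v u * G2 u) / (G1 u) ^ 2 =
        v1 u * (G1 u)⁻¹ - v u * G2 u * ((G1 u)⁻¹ * (G1 u)⁻¹) := by
      have := h0' u hu
      field_simp
    rw [e]
    have hpu := hp u hu
    set p := (G1 u)⁻¹
    have hp2 : |p| ≤ 2 := hpu.trans hη2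
    have : (2 / η) * (2 / η) = 4 / η ^ 2 := by field_simp; norm_num
    calc _ ≤ |v1 u * p| + |v u * G2 u * (p * p)| := abs_sub _ _
      _ = |v1 u| * |p| + |v u| * |G2 u| * (|p| * |p|) := by simp only [abs_mul]
      _ ≤ (15 * (2 / η) * (W * E ^ 2 / u ^ 2)) * (2 / η)
          + (3 * (2 / η) * (W * E / u)) * (E / u) * (2 * (2 / η)) := by
          gcongr
          · exact bv1 u hu
          · exact bv u hu
          · exact bG2 u hu
      _ = 21 * (W * E ^ 2) * ((2 / η) * (2 / η)) * (1 / u ^ 2) := by ring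
      _ = _ := by rw [this]; ring
  have bb : ∀ u ∈ Icc a b, |v u / G1 u| ≤ 12 * (W * E ^ 2 / η ^ 2) := by
    intro u hu
    have hu1 : 1 ≤ u := by linarith [hu.1]
    rw [div_eq_mul_inv, abs_mul]
    calc _ ≤ (3 * (2 / η) * (W * E / u)) * (2 / η) := by
          gcongr
          · exact bv u hu
          · exact hp u hu
      _ ≤ (3 * (2 / η) * (W * E ^ 2 / 1)) * (2 / η) := by
          gcongr; nlinarith
      _ = _ := by field_simp; ring
  have hI2 : ‖∫ u in a..b, (((v1 u * G1 u - v u * G2 u) / (G1 u) ^ 2 : ℝ) : ℂ) * ee (G u)‖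
      ≤ 84 * (W * E ^ 2 / η ^ 2) := by
    have cinv : ContinuousOn (fun u : ℝ => (1 / u ^ 2)) (Icc a b) := by
      apply continuousOn_const.div (continuousOn_id.pow 2)
      intro u hu; have : 0 < u := by linarith [hu.1]
      exact pow_ne_zero 2 this.ne.symm
    have i1 : ∫ u in a..b, (1 / u ^ 2 : ℝ) = -b⁻¹ - -a⁻¹ := by
      apply intervalIntegral.integral_eq_sub_of_hasDerivAt (f := fun u : ℝ => -u⁻¹)
      · rw [hI]; intro u hu
        have : u ≠ 0 := by have : 0 < u := by linarith [hu.1]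
                           positivity
        have := (hasDerivAt_inv this).neg
        convert! this using 1
        rw [neg_neg, one_div]
      · exact ContinuousOn.intervalIntegrable (by rw [hI]; exact cinv)
    have := intervalIntegral.norm_integral_le_of_norm_le (μ := volume) hab
      (f := fun u => (((v1 u * G1 u - v u * G2 u) / (G1 u) ^ 2 : ℝ) : ℂ) * ee (G u))
      (g := fun u => 84 * (W * E ^ 2 / η ^ 2) * (1 / u ^ 2))
      (Filter.Eventually.of_forall (fun u hu => by
        rw [norm_mul, ee_norm, mul_one, Complex.norm_real, Real.norm_eq_abs]
        exact bq u ⟨hu.1.le, hu.2⟩))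
      (ContinuousOn.intervalIntegrable (by rw [hI]; exact continuousOn_const.mul cinv))
    refine this.trans ?_
    rw [intervalIntegral.integral_const_mul, i1]
    have hb' : 0 ≤ b⁻¹ := inv_nonneg.2 (by linarith)
    have ha' : a⁻¹ ≤ 1 := inv_le_one_of_one_le₀ ha
    exact mul_le_of_le_one_right (by positivity) (by linarith)
  have hpi : ‖1 / (2 * (Real.pi : ℂ) * Complex.I)‖ ≤ 1 := by
    rw [norm_div, two_pi_I_norm, norm_one, div_le_one (by positivity)]
    linarith [Real.pi_gt_three]
  rw [e1, ← mul_sub, show ∀ x y : ℂ, x - y - x = -y by intros; ring, norm_mul, norm_neg]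
  refine (mul_le_of_le_one_left (norm_nonneg _) hpi).trans ?_
  change ‖∫ u in a..b, (v u : ℂ) * ee (G u)‖ ≤ _
  rw [e2, norm_mul]
  refine (mul_le_of_le_one_left (norm_nonneg _) hpi).trans ?_
  refine (norm_sub_le _ _).trans ?_
  have t1 : ‖((v b / G1 b : ℝ) : ℂ) * ee (G b) - ((v a / G1 a : ℝ) : ℂ) * ee (G a)‖
      ≤ 24 * (W * E ^ 2 / η ^ 2) := by
    refine (norm_sub_le _ _).trans ?_
    rw [norm_mul, norm_mul, ee_norm, ee_norm, mul_one, mul_one, Complex.norm_real, Complex.norm_real,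
      Real.norm_eq_abs, Real.norm_eq_abs]
    linarith [bb a haI, bb b hbI]
  linarith


noncomputable def Tint (κ : ℝ) (g : ℝ → ℝ) (a b : ℝ) (h : ℤ) : ℂ :=
  ∫ u in a..b, ((u ^ (-κ) : ℝ) : ℂ) * ee (g u - h * u)

structure PhaseB (g : ℝ → ℝ) (a b L B : ℝ) where
  g1 : ℝ → ℝ
  g2 : ℝ → ℝ
  g3 : ℝ → ℝ
  h1 : ∀ u : ℝ, 0 < u → HasDerivAt g (g1 u) u
  h2 : ∀ u : ℝ, 0 < u → HasDerivAt g1 (g2 u) u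
  h3 : ∀ u : ℝ, 0 < u → HasDerivAt g2 (g3 u) u
  c3 : ContinuousOn g3 (Ioi 0)
  b1 : ∀ u ∈ Icc a b, |g1 u| ≤ L
  b2 : ∀ u ∈ Icc a b, |g2 u| ≤ B / u
  b3 : ∀ u ∈ Icc a b, |g3 u| ≤ B / u ^ 2

lemma single_bound {g : ℝ → ℝ} {a b L B κ : ℝ} (P : PhaseB g a b L B) (hκ : 0 < κ) (hB : 0 ≤ B)
    (ha : 1 ≤ a) (hab : a ≤ b) (h : ℤ) (hh : 1 ≤ |(h : ℝ)|) (hL : 2 * L ≤ |(h : ℝ)|) :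
    ‖Tint κ g a b h - (1 / (2 * (Real.pi : ℂ) * Complex.I)) *
      (((b ^ (-κ) / (P.g1 b - h) : ℝ) : ℂ) * ee (g b - h * b)
        - ((a ^ (-κ) / (P.g1 a - h) : ℝ) : ℂ) * ee (g a - h * a))‖
      ≤ 108 * (a ^ (-κ) * (B + κ * (κ + 1) + 1) ^ 2 / |(h : ℝ)| ^ 2) := by
  have hpos : ∀ u ∈ Icc a b, 0 < u := fun u hu => by linarith [hu.1]
  have ha0 : 0 < a := by linarith
  have hW : ∀ u ∈ Icc a b, u ^ (-κ) ≤ a ^ (-κ) := fun u hu =>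
    Real.rpow_le_rpow_of_nonpos ha0 hu.1 (by linarith)
  have e1 : ∀ u ∈ Icc a b, u ^ (-κ - 1) = u ^ (-κ) / u := fun u hu => by
    rw [Real.rpow_sub (hpos u hu), Real.rpow_one]
  have e2 : ∀ u ∈ Icc a b, u ^ (-κ - 1 - 1) = u ^ (-κ) / u ^ 2 := fun u hu => by
    rw [Real.rpow_sub (hpos u hu), Real.rpow_one, e1 u hu, div_div, sq]
  have hkk : 0 ≤ κ * κ := by positivity
  exact osc_two (a := a) (b := b) (η := |(h : ℝ)|) (W := a ^ (-κ)) (E := B + κ * (κ + 1) + 1) ha hab hh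
    (by nlinarith) (by positivity)
    (w := fun u => u ^ (-κ)) (w1 := fun u => -κ * u ^ (-κ - 1))
    (w2 := fun u => -κ * ((-κ - 1) * u ^ (-κ - 1 - 1)))
    (G := fun u => g u - h * u) (G1 := fun u => P.g1 u - h) (G2 := P.g2) (G3 := P.g3)
    (fun u hu => rpow_hasDeriv κ u (hpos u hu))
    (fun u hu => (Real.hasDerivAt_rpow_const (Or.inl (hpos u hu).ne')).const_mul _)
    (fun u hu => by
      have := (P.h1 u (hpos u hu)).sub ((hasDerivAt_id u).const_mul (h : ℝ))
      convert! this using 1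
      simp)
    (fun u hu => (P.h2 u (hpos u hu)).sub_const _)
    (fun u hu => P.h3 u (hpos u hu))
    (fun u hu => by
      have h1 := P.b1 u hu
      have h2 := abs_sub_abs_le_abs_sub (h : ℝ) (P.g1 u)
      rw [abs_sub_comm] at h2
      linarith)
    (by
      apply continuousOn_const.mul
      apply continuousOn_const.mul
      intro u hu
      exact (Real.continuousAt_rpow_const _ _ (Or.inl (hpos u hu).ne')).continuousWithinAt)
    (P.c3.mono (fun u hu => hpos u hu))
    (fun u hu => by
      have := hpos u hu
      rw [abs_of_nonneg (by positivity)]; exact hW u hu)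
    (fun u hu => by
      have h0 := hpos u hu
      rw [e1 u hu, abs_mul, abs_neg, abs_of_pos hκ, abs_of_nonneg (by positivity), mul_div_assoc',
        mul_comm κ]
      refine div_le_div_of_nonneg_right (mul_le_mul (hW u hu) ?_ hκ.le (by positivity)) h0.le
      nlinarith)
    (fun u hu => by
      have h0 := hpos u hu
      rw [e2 u hu, show -κ * ((-κ - 1) * (u ^ (-κ) / u ^ 2)) = u ^ (-κ) * (κ * (κ + 1)) / u ^ 2 by ring,
        abs_of_nonneg (by positivity)]
      refine div_le_div_of_nonneg_right (mul_le_mul (hW u hu) ?_ (by positivity) (by positivity)) (by positivity)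
      linarith)
    (fun u hu => by
      have h0 := hpos u hu
      refine (P.b2 u hu).trans ?_
      gcongr
      nlinarith)
    (fun u hu => by
      have h0 := hpos u hu
      refine (P.b3 u hu).trans ?_
      gcongr
      nlinarith)

lemma pair_bound {g : ℝ → ℝ} {X N : ℕ} {L B κ : ℝ} (P : PhaseB g X N L B) (hκ : 0 < κ) (hB : 0 ≤ B)
    (hX : 1 ≤ X) (hXN : X ≤ N) (h : ℕ) (hh : 1 ≤ h) (hL : 2 * L ≤ h) :
    ‖Tint κ g X N h + Tint κ g X N (-h)‖ ≤
      222 * ((X : ℝ) ^ (-κ) * (B + κ * (κ + 1) + 1) ^ 2 * (1 + L)) * (1 / (h : ℝ) ^ 2) := by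
  have hX1 : (1 : ℝ) ≤ X := by exact_mod_cast hX
  have hXNr : (X : ℝ) ≤ N := by exact_mod_cast hXN
  have hh1 : (1 : ℝ) ≤ h := by exact_mod_cast hh
  have s1 := single_bound P hκ hB hX1 hXNr (h : ℤ) (by simpa using hh1) (by simpa using hL)
  have s2 := single_bound P hκ hB hX1 hXNr (-(h : ℤ)) (by simpa using hh1) (by simpa using hL)
  have eei : ∀ (k : ℤ) (n : ℕ), ee (g n - k * n) = ee (g n) := by
    intro k n
    have : g n - k * n = g n + ((-(k * n) : ℤ) : ℝ) := by push_cast; ring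
    rw [this, ee_add, ee_int, mul_one]
  rw [eei, eei] at s1 s2
  have L0 : 0 ≤ L := (abs_nonneg _).trans (P.b1 X ⟨le_rfl, hXNr⟩)
  set W := (X : ℝ) ^ (-κ) with hW
  have hW0 : 0 ≤ W := by positivity
  set E := B + κ * (κ + 1) + 1 with hE
  have hE1 : 1 ≤ E := by have : 0 ≤ κ * (κ + 1) := by positivity
                         linarith
  have bd : ∀ n : ℕ, (n : ℝ) ∈ Icc (X : ℝ) N →
      |(n : ℝ) ^ (-κ) / (P.g1 n - ((h : ℤ) : ℝ)) + (n : ℝ) ^ (-κ) / (P.g1 n - ((-(h : ℤ) : ℤ) : ℝ))|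
       ≤ W * (3 * L / (h : ℝ) ^ 2) := by
    intro n hn
    have g1b := P.b1 n hn
    have ab := abs_le.1 g1b
    have p1 : P.g1 n - (h : ℝ) ≠ 0 := by intro h0; linarith
    have p2 : P.g1 n + (h : ℝ) ≠ 0 := by intro h0; linarith
    have sq1 : (P.g1 n) ^ 2 ≤ (h : ℝ) ^ 2 / 4 := by nlinarith
    have hsq : (0 : ℝ) < (h : ℝ) ^ 2 := by positivity
    have : (n : ℝ) ^ (-κ) / (P.g1 n - ((h : ℤ) : ℝ)) + (n : ℝ) ^ (-κ) / (P.g1 n - ((-(h : ℤ) : ℤ) : ℝ))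
        = (n : ℝ) ^ (-κ) * (-(2 * P.g1 n / ((h : ℝ) ^ 2 - (P.g1 n) ^ 2))) := by
      have p3 : (h : ℝ) ^ 2 - (P.g1 n) ^ 2 ≠ 0 := by nlinarith
      push_cast
      rw [sub_neg_eq_add]
      field_simp
      ring
    rw [this, abs_mul, abs_neg, abs_div, abs_mul, abs_two,
      abs_of_pos (show 0 < (h : ℝ) ^ 2 - (P.g1 n) ^ 2 by linarith), abs_of_nonneg (by positivity)]
    have hn0 : (0 : ℝ) < n := by linarith [hn.1]
    refine mul_le_mul (Real.rpow_le_rpow_of_nonpos (by linarith) hn.1 (by linarith)) ?_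
      (div_nonneg (by positivity) (by linarith)) hW0
    · rw [div_le_div_iff₀ (by linarith) hsq]
      nlinarith
  have dec : Tint κ g X N h + Tint κ g X N (-h) =
      (Tint κ g X N h - (1 / (2 * (Real.pi : ℂ) * Complex.I)) *
      ((((N : ℝ) ^ (-κ) / (P.g1 N - ((h : ℤ) : ℝ)) : ℝ) : ℂ) * ee (g N)
        - (((X : ℝ) ^ (-κ) / (P.g1 X - ((h : ℤ) : ℝ)) : ℝ) : ℂ) * ee (g X))) +
      (Tint κ g X N (-h) - (1 / (2 * (Real.pi : ℂ) * Complex.I)) *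
      ((((N : ℝ) ^ (-κ) / (P.g1 N - ((-(h : ℤ) : ℤ) : ℝ)) : ℝ) : ℂ) * ee (g N)
        - (((X : ℝ) ^ (-κ) / (P.g1 X - ((-(h : ℤ) : ℤ) : ℝ)) : ℝ) : ℂ) * ee (g X))) +
      (1 / (2 * (Real.pi : ℂ) * Complex.I)) *
      (((((N : ℝ) ^ (-κ) / (P.g1 N - ((h : ℤ) : ℝ)) + (N : ℝ) ^ (-κ) / (P.g1 N - ((-(h : ℤ) : ℤ) : ℝ))) : ℝ) : ℂ) * ee (g N)
      - ((((X : ℝ) ^ (-κ) / (P.g1 X - ((h : ℤ) : ℝ)) + (X : ℝ) ^ (-κ) / (P.g1 X - ((-(h : ℤ) : ℤ) : ℝ))) : ℝ) : ℂ) * ee (g X)) := by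
    push_cast; ring
  have hpi : ‖1 / (2 * (Real.pi : ℂ) * Complex.I)‖ ≤ 1 := by
    rw [norm_div, two_pi_I_norm, norm_one, div_le_one (by positivity)]
    linarith [Real.pi_gt_three]
  have s3 : ‖(1 / (2 * (Real.pi : ℂ) * Complex.I)) *
      (((((N : ℝ) ^ (-κ) / (P.g1 N - ((h : ℤ) : ℝ)) + (N : ℝ) ^ (-κ) / (P.g1 N - ((-(h : ℤ) : ℤ) : ℝ))) : ℝ) : ℂ) * ee (g N)
      - ((((X : ℝ) ^ (-κ) / (P.g1 X - ((h : ℤ) : ℝ)) + (X : ℝ) ^ (-κ) / (P.g1 X - ((-(h : ℤ) : ℤ) : ℝ))) : ℝ) : ℂ) * ee (g X))‖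
      ≤ 2 * (W * (3 * L / (h : ℝ) ^ 2)) := by
    rw [norm_mul]
    refine (mul_le_of_le_one_left (norm_nonneg _) hpi).trans ?_
    refine (norm_sub_le _ _).trans ?_
    rw [norm_mul, norm_mul, ee_norm, ee_norm, mul_one, mul_one, Complex.norm_real, Complex.norm_real,
      Real.norm_eq_abs, Real.norm_eq_abs]
    linarith [bd N ⟨hXNr, le_rfl⟩, bd X ⟨le_rfl, hXNr⟩]
  rw [dec]
  refine (norm_add₃_le).trans ?_
  have habs1 : |(((h : ℤ) : ℤ) : ℝ)| = h := by simp
  have habs2 : |((-(h : ℤ) : ℤ) : ℝ)| = h := by simp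
  rw [habs1] at s1
  rw [habs2] at s2
  refine (add_le_add (add_le_add s1 s2) s3).trans ?_
  have hsq : (0 : ℝ) < (h : ℝ) ^ 2 := by positivity
  have e1 : 108 * (W * E ^ 2 / (h : ℝ) ^ 2) + 108 * (W * E ^ 2 / (h : ℝ) ^ 2) + 2 * (W * (3 * L / (h : ℝ) ^ 2))
     = (216 * (W * E ^ 2) + 6 * (W * L)) * (1 / (h : ℝ) ^ 2) := by ring
  rw [e1]
  apply mul_le_mul_of_nonneg_right _ (by positivity)
  have hEE : 1 ≤ E ^ 2 := by nlinarith
  have q1 : W * L ≤ W * E ^ 2 * L := by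
    have := mul_le_mul_of_nonneg_left hEE (mul_nonneg hW0 L0)
    nlinarith
  have q2 : 0 ≤ W * E ^ 2 * L := by positivity
  have q3 : 0 ≤ W * E ^ 2 := by positivity
  nlinarith


lemma ee_fourier (h : ℤ) (x : ℝ) : (fourier (T := (1:ℝ)) (-h)) (x : AddCircle (1:ℝ)) = ee (-(h * x)) := by
  rw [fourier_coe_apply]; unfold ee; congr 1; push_cast; ring

lemma unit_split (f : ℝ → ℂ) (X N : ℕ) (hXN : X ≤ N) (cf : ContinuousOn f (Icc X N)) (h : ℤ) :
    ∫ x in (0:ℝ)..1, ee (-(h * x)) * ∑ n ∈ Finset.Ico X N, f (n + x)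
      = ∫ u in (X:ℝ)..N, f u * ee (-(h * u)) := by
  have cF : ContinuousOn (fun u => f u * ee (-(h * u))) (Icc X N) :=
    cf.mul (ee_cont.comp_continuousOn (by fun_prop))
  have s1 : ∀ n ∈ Finset.Ico X N, ∫ x in (0:ℝ)..1, ee (-(h * x)) * f (n + x)
      = ∫ u in (n:ℝ)..((n+1 : ℕ) : ℝ), f u * ee (-(h * u)) := by
    intro n hn
    have := intervalIntegral.integral_comp_add_left (a := 0) (b := 1)
      (fun u => f u * ee (-(h * u))) (n : ℝ)
    rw [add_zero] at this
    push_cast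
    rw [← this]
    apply intervalIntegral.integral_congr
    intro x _
    simp only
    have : -(h * ((n:ℝ) + x)) = -(h * x) + ((-(h * n) : ℤ) : ℝ) := by push_cast; ring
    rw [this, ee_add, ee_int]; ring
  have hsub : ∀ n ∈ Finset.Ico X N, Icc (n:ℝ) ((n+1 : ℕ) : ℝ) ⊆ Icc (X:ℝ) N := by
    intro n hn
    rw [Finset.mem_Ico] at hn
    apply Icc_subset_Icc
    · exact_mod_cast hn.1
    · exact_mod_cast hn.2
  have cfn : ∀ n ∈ Finset.Ico X N, ContinuousOn (fun x : ℝ => f (n + x)) (Icc 0 1) := by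
    intro n hn
    apply cf.comp (by fun_prop)
    intro x hx
    apply hsub n hn
    push_cast
    exact ⟨by linarith [hx.1], by linarith [hx.2]⟩
  simp_rw [Finset.mul_sum]
  rw [intervalIntegral.integral_finsetSum]
  · rw [Finset.sum_congr rfl s1]
    exact intervalIntegral.sum_integral_adjacent_intervals_Ico (a := fun n : ℕ => (n:ℝ)) hXN (by
      intro k hk
      apply ContinuousOn.intervalIntegrable
      rw [uIcc_of_le (by push_cast; linarith)]
      exact cF.mono (hsub k (by simpa using hk)))
  · intro n hn
    apply ContinuousOn.intervalIntegrable
    rw [uIcc_of_le zero_le_one]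
    exact (ee_cont.comp_continuousOn (by fun_prop)).mul (cfn n hn)

lemma poisson_abs (f : ℝ → ℂ) (X N : ℕ) (hXN : X ≤ N) (cf : ContinuousOn f (Icc X N)) (T : ℤ → ℂ)
    (hT : ∀ h : ℤ, T h = ∫ u in (X:ℝ)..N, f u * ee (-(h * u)))
    (hs : Summable (fun h : ℤ => (T h + T (-h)) / 2)) :
    HasSum (fun h : ℤ => (T h + T (-h)) / 2)
      ((∑ n ∈ Finset.Ico X N, f n + ∑ n ∈ Finset.Ioc X N, f n) / 2) := by
  set G : ℝ → ℂ := fun x => ∑ n ∈ Finset.Ico X N, f (n + x) with hG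
  set p : ℝ → ℂ := fun x => (G x + G (1 - x)) / 2 with hp
  have cG : ContinuousOn G (Icc 0 1) := by
    apply continuousOn_finsetSum
    intro n hn
    rw [Finset.mem_Ico] at hn
    apply cf.comp (by fun_prop)
    intro x hx
    have h1 : (X:ℝ) ≤ n := by exact_mod_cast hn.1
    have h2 : (n:ℝ) + 1 ≤ N := by exact_mod_cast hn.2
    exact ⟨by linarith [hx.1], by linarith [hx.2]⟩
  have cG' : ContinuousOn (fun x => G (1 - x)) (Icc 0 1) := by
    apply cG.comp (by fun_prop)
    intro x hx
    exact ⟨by linarith [hx.2], by linarith [hx.1]⟩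
  have cp : ContinuousOn p (Icc 0 1) := (cG.add cG').div_const 2
  haveI : Fact ((0:ℝ) < 1) := ⟨one_pos⟩
  have p01 : p 0 = p 1 := by simp only [hp]; rw [sub_zero, sub_self, add_comm]
  set q : C(AddCircle (1:ℝ), ℂ) := ⟨AddCircle.liftIco 1 0 p, AddCircle.liftIco_zero_continuous p01 cp⟩ with hq
  have hint : ∀ (h : ℤ) (F : ℝ → ℂ), ContinuousOn F (Icc 0 1) →
      IntervalIntegrable (fun x => ee (-(h * x)) * F x) volume 0 1 := by
    intro h F hF
    apply ContinuousOn.intervalIntegrable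
    rw [uIcc_of_le zero_le_one]
    exact (ee_cont.comp_continuousOn (by fun_prop)).mul hF
  have coeff : ∀ h : ℤ, fourierCoeff q h = (T h + T (-h)) / 2 := by
    intro h
    have : fourierCoeff (⇑q) h = fourierCoeff (AddCircle.liftIco 1 0 p) h := rfl
    rw [this, fourierCoeff_liftIco_eq, fourierCoeffOn_eq_integral]
    have ef : ∀ x : ℝ, (fourier (T := (0 + 1 - 0 : ℝ)) (-h)) (x : AddCircle (0 + 1 - 0 : ℝ)) = ee (-(h * x)) := by
      intro x
      rw [fourier_coe_apply]; unfold ee; congr 1; push_cast; ring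
    simp_rw [ef]
    simp only [smul_eq_mul, zero_add, sub_zero, div_one, one_smul]
    have e1 : ∀ x : ℝ, ee (-(h * x)) * p x = (1/2 : ℂ) * (ee (-(h * x)) * G x)
        + (1/2 : ℂ) * (ee (-(h * x)) * G (1 - x)) := by
      intro x; simp only [hp]; ring
    simp_rw [e1]
    rw [intervalIntegral.integral_add ((hint h G cG).const_mul _) ((hint h _ cG').const_mul _),
      intervalIntegral.integral_const_mul, intervalIntegral.integral_const_mul]
    have e2 : ∫ x in (0:ℝ)..1, ee (-(h * x)) * G (1 - x) = ∫ x in (0:ℝ)..1, ee (-((-h : ℤ) * x)) * G x := by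
      have := intervalIntegral.integral_comp_sub_left (a := 0) (b := 1)
        (fun x => ee (-((-h : ℤ) * x)) * G x) 1
      rw [sub_zero, sub_self] at this
      rw [← this]
      apply intervalIntegral.integral_congr
      intro x _
      simp only
      have : -(((-h : ℤ) : ℝ) * (1 - x)) = -(h * x) + (h : ℤ) := by push_cast; ring
      rw [this, ee_add, ee_int, mul_one]
    rw [e2]
    simp only [hG]
    rw [unit_split f X N hXN cf h, unit_split f X N hXN cf (-h), ← hT, ← hT]
    ring
  have hsum : Summable (fourierCoeff (⇑q)) := by
    have : fourierCoeff (⇑q) = (fun h : ℤ => (T h + T (-h)) / 2) := funext coeff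
    rw [this]; exact hs
  have key := has_pointwise_sum_fourier_series_of_summable hsum (((0:ℝ) : AddCircle (1:ℝ)))
  have v0 : q (((0:ℝ) : AddCircle (1:ℝ))) = p 0 := by
    change AddCircle.liftIco 1 0 p _ = _
    rw [AddCircle.liftIco_coe_apply (by simp)]
  have hp0 : p 0 = (∑ n ∈ Finset.Ico X N, f n + ∑ n ∈ Finset.Ioc X N, f n) / 2 := by
    simp only [hp, hG, add_zero, sub_zero]
    congr 2
    have : Finset.Ioc X N = Finset.Ico (X+1) (N+1) := by ext; simp; try omega
    rw [this, ← Finset.sum_Ico_add' (fun n : ℕ => f n) X N 1]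
    apply Finset.sum_congr rfl
    intro n _; push_cast; rfl
  rw [v0, hp0] at key
  convert! key using 1
  funext h
  rw [coeff, fourier_coe_apply]
  simp


lemma tail_abs (T : ℤ → ℂ) (S : ℂ) (A : ℝ) (hA0 : 0 ≤ A) (K : ℕ)
    (pb : ∀ h : ℕ, K + 1 ≤ h → ‖T h + T (-h)‖ ≤ A * (1 / (h:ℝ)^2))
    (HS : Summable (fun h : ℤ => (T h + T (-h)) / 2) → HasSum (fun h : ℤ => (T h + T (-h)) / 2) S) :
    ‖S - ∑ h ∈ Finset.Icc (-(K:ℤ)) K, T h‖ ≤ A * (2 / (K + 1)) := by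
  have hsn : Summable (fun h : ℕ => (T (h:ℤ) + T (-(h:ℤ))) / 2) := by
    rw [← summable_nat_add_iff (K+1)]
    have sA : Summable (fun h : ℕ => A * (1 / ((h + (K+1) : ℕ):ℝ)^2)) :=
      ((summable_nat_add_iff (f := fun h : ℕ => 1 / (h:ℝ)^2) (K+1)).2 (Real.summable_one_div_nat_pow.2 one_lt_two)).mul_left A
    refine Summable.of_norm_bounded sA ?_
    intro h
    rw [norm_div]
    have := pb (h + (K+1)) (by omega)
    have h2 : ‖(2:ℂ)‖ = 2 := by simp
    rw [h2]
    linarith [norm_nonneg (T ((h + (K+1) : ℕ):ℤ) + T (-((h + (K+1) : ℕ):ℤ)))]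
  have hs : Summable (fun h : ℤ => (T h + T (-h)) / 2) := by
    apply Summable.of_nat_of_neg (f := fun h : ℤ => (T h + T (-h)) / 2) hsn
    refine hsn.congr ?_
    intro h
    rw [neg_neg, add_comm]
  have key := (HS hs).nat_add_neg
  have key2 : HasSum (fun n : ℕ => T n + T (-n)) (S + T 0) := by
    convert! key using 1
    · funext n; simp only [neg_neg]; ring
    · simp
  have fin : ∑ h ∈ Finset.Icc (-(K:ℤ)) K, T h = ∑ n ∈ Finset.range (K+1), (T n + T (-n)) - T 0 := by
    clear pb hsn
    induction K with
    | zero => simp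
    | succ k ih =>
      have : Finset.Icc (-((k+1 : ℕ):ℤ)) ((k+1 : ℕ):ℤ)
          = insert ((k+1 : ℕ):ℤ) (insert (-((k+1 : ℕ):ℤ)) (Finset.Icc (-(k:ℤ)) k)) := by
        ext x; simp only [Finset.mem_Icc, Finset.mem_insert]; omega
      rw [this, Finset.sum_insert, Finset.sum_insert, ih, Finset.sum_range_succ _ (k+1)]
      · ring
      · simp
      · simp only [Finset.mem_Icc, Finset.mem_insert]; omega
  rw [fin]
  have lim := (key2.tendsto_sum_nat).sub_const (∑ n ∈ Finset.range (K+1), (T n + T (-n)))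
  have lim2 := lim.norm
  have e : S - (∑ n ∈ Finset.range (K+1), (T n + T (-n)) - T 0)
      = S + T 0 - ∑ n ∈ Finset.range (K+1), (T n + T (-n)) := by ring
  rw [e]
  refine le_of_tendsto lim2 ?_
  filter_upwards [Filter.eventually_ge_atTop (K+1)] with R hR
  rw [← Finset.sum_Ico_eq_sub _ hR]
  refine (norm_sum_le _ _).trans ?_
  calc _ ≤ ∑ i ∈ Finset.Ico (K+1) R, A * ((i:ℝ)^2)⁻¹ := by
        apply Finset.sum_le_sum
        intro i hi
        rw [Finset.mem_Ico] at hi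
        rw [← one_div]
        exact pb i hi.1
    _ = A * ∑ i ∈ Finset.Ioo K R, ((i:ℝ)^2)⁻¹ := by
        rw [← Finset.mul_sum]
        congr 2
    _ ≤ A * (2 / (K+1)) := by
        gcongr
        exact sum_Ioo_inv_sq_le K R

lemma poisson {g : ℝ → ℝ} {X N : ℕ} {L B κ : ℝ} (P : PhaseB g X N L B) (hκ : 0 < κ) (hB : 0 ≤ B)
    (hX : 1 ≤ X) (hXN : X ≤ N) (K : ℕ) (hK : 2 * L ≤ K + 1) :
    ‖(∑ n ∈ Finset.Ico X N, (((n:ℝ) ^ (-κ) : ℝ) : ℂ) * ee (g n)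
        + ∑ n ∈ Finset.Ioc X N, (((n:ℝ) ^ (-κ) : ℝ) : ℂ) * ee (g n)) / 2
      - ∑ h ∈ Finset.Icc (-(K:ℤ)) K, Tint κ g X N h‖
      ≤ 444 * ((X : ℝ) ^ (-κ) * (B + κ * (κ + 1) + 1) ^ 2) * ((1 + L) / (K + 1)) := by
  have hX1 : (1 : ℝ) ≤ X := by exact_mod_cast hX
  have hXNr : (X : ℝ) ≤ N := by exact_mod_cast hXN
  have L0 : 0 ≤ L := (abs_nonneg _).trans (P.b1 X ⟨le_rfl, hXNr⟩)
  set A := 222 * ((X : ℝ) ^ (-κ) * (B + κ * (κ + 1) + 1) ^ 2 * (1 + L)) with hA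
  have hA0 : 0 ≤ A := by positivity
  have pb : ∀ h : ℕ, K + 1 ≤ h → ‖Tint κ g X N h + Tint κ g X N (-h)‖ ≤ A * (1 / (h:ℝ)^2) := by
    intro h hh
    have h2 : ((K:ℝ) + 1) ≤ h := by exact_mod_cast hh
    exact pair_bound P hκ hB hX hXN h (by omega) (by linarith)
  set f : ℝ → ℂ := fun u => ((u ^ (-κ) : ℝ) : ℂ) * ee (g u) with hf
  have cf : ContinuousOn f (Icc X N) := by
    have hpos : ∀ u ∈ Icc (X:ℝ) N, 0 < u := fun u hu => by linarith [hu.1]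
    apply ContinuousOn.mul
    · apply Complex.continuous_ofReal.comp_continuousOn
      exact fun u hu => (rpow_hasDeriv κ u (hpos u hu)).continuousAt.continuousWithinAt
    · exact ee_cont.comp_continuousOn (fun u hu => (P.h1 u (hpos u hu)).continuousAt.continuousWithinAt)
  have hT : ∀ h : ℤ, Tint κ g X N h = ∫ u in (X:ℝ)..N, f u * ee (-(h * u)) := by
    intro h
    simp only [Tint, hf]
    apply intervalIntegral.integral_congr
    intro u _
    simp only
    rw [sub_eq_add_neg, ee_add, mul_assoc]
  refine (tail_abs (Tint κ g X N) _ A hA0 K pb (poisson_abs f X N hXN cf (Tint κ g X N) hT)).trans (le_of_eq ?_)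
  rw [hA]; ring


noncomputable def zt (κ y : ℝ) (m : ℕ) : ℂ := (((m:ℝ) ^ (-κ) : ℝ) : ℂ) * ee (y * Real.log m)

noncomputable def wz (κ y : ℝ) : ℂ := (κ : ℂ) - 2 * (Real.pi : ℂ) * Complex.I * (y : ℂ)

lemma zt_norm (κ y : ℝ) (m : ℕ) : ‖zt κ y m‖ = (m:ℝ) ^ (-κ) := by
  unfold zt
  rw [norm_mul, ee_norm, mul_one, Complex.norm_real, Real.norm_of_nonneg (by positivity)]

lemma zt_cpow (κ y : ℝ) (hκ : κ ≠ 0) (m : ℕ) : 1 / (m : ℂ) ^ (wz κ y) = zt κ y m := by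
  have hw : wz κ y ≠ 0 := by
    intro h
    have := congrArg Complex.re h
    simp [wz] at this
    exact hκ this
  rcases Nat.eq_zero_or_pos m with h | h
  · subst h
    unfold zt
    rw [Nat.cast_zero, Complex.zero_cpow hw, Nat.cast_zero, Real.zero_rpow (by simpa using hκ)]
    simp
  · have hm : (m : ℂ) ≠ 0 := by exact_mod_cast h.ne'
    have hm' : (0:ℝ) < m := by exact_mod_cast h
    rw [one_div, ← Complex.cpow_neg, Complex.cpow_def_of_ne_zero hm]
    unfold zt ee
    rw [Real.rpow_def_of_pos hm', Complex.ofReal_exp, ← Complex.exp_add]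
    congr 1
    rw [← Complex.natCast_log]
    unfold wz
    push_cast
    ring

noncomputable def zphase (y : ℝ) (P Q : ℕ) (hP : 1 ≤ P) (hy : 0 < y) (hyP : 2 * y ≤ P) :
    PhaseB (fun u => y * Real.log u) P Q (1/2) 1 where
  g1 := fun u => y * u⁻¹
  g2 := fun u => y * (-(u^2)⁻¹)
  g3 := fun u => y * (2 * (u^3)⁻¹)
  h1 := fun u hu => (Real.hasDerivAt_log hu.ne').const_mul y
  h2 := fun u hu => (hasDerivAt_inv hu.ne').const_mul y
  h3 := fun u hu => by
    have h := ((hasDerivAt_pow 2 u).inv (pow_ne_zero 2 hu.ne')).neg.const_mul y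
    convert! h using 1
    field_simp
    simp
  c3 := by
    apply continuousOn_const.mul
    apply continuousOn_const.mul
    apply ContinuousOn.inv₀ (by fun_prop)
    intro u hu
    exact pow_ne_zero 3 (ne_of_gt hu)
  b1 := fun u hu => by
    have hP' : (1:ℝ) ≤ P := by exact_mod_cast hP
    have hu0 : 0 < u := by linarith [hu.1]
    rw [abs_of_pos (by positivity), ← div_eq_mul_inv, div_le_iff₀ hu0]
    linarith [hu.1]
  b2 := fun u hu => by
    have hP' : (1:ℝ) ≤ P := by exact_mod_cast hP
    have hu0 : 0 < u := by linarith [hu.1]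
    rw [mul_neg, abs_neg, abs_of_pos (by positivity), ← div_eq_mul_inv, div_le_div_iff₀ (by positivity) hu0]
    nlinarith [hu.1]
  b3 := fun u hu => by
    have hP' : (1:ℝ) ≤ P := by exact_mod_cast hP
    have hu0 : 0 < u := by linarith [hu.1]
    rw [abs_of_pos (by positivity), ← mul_assoc, ← div_eq_mul_inv, div_le_div_iff₀ (by positivity) (by positivity)]
    have : 0 < u^2 := by positivity
    nlinarith [hu.1]

lemma Tint_zero_bound {κ y : ℝ} (hκ : 1 ≤ κ) (hy : 0 < y) {a b : ℝ} (ha : 1 ≤ a) (hab : a ≤ b) :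
    ‖Tint κ (fun u => y * Real.log u) a b 0‖ ≤ 1 / y := by
  set s : ℂ := ((1 - κ : ℝ) : ℂ) + 2 * (Real.pi : ℂ) * Complex.I * (y : ℂ) with hs
  have his : s.im = 2 * Real.pi * y := by simp [hs]
  have hpi := Real.pi_gt_three
  have hsn : 2 * y ≤ ‖s‖ := by
    have := Complex.abs_im_le_norm s
    rw [his, abs_of_pos (by positivity)] at this
    nlinarith
  have hs0 : s ≠ 0 := by
    intro h; rw [h, norm_zero] at hsn; linarith
  set Fp : ℝ → ℂ := fun u => s⁻¹ * (((u ^ (1 - κ) : ℝ) : ℂ) * ee (y * Real.log u)) with hF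
  have hder : ∀ u : ℝ, 0 < u → HasDerivAt Fp (((u ^ (-κ) : ℝ) : ℂ) * ee (y * Real.log u - ((0:ℤ):ℝ) * u)) u := by
    intro u hu
    have h1 : HasDerivAt (fun u : ℝ => ((u ^ (1 - κ) : ℝ) : ℂ)) (((1 - κ) * u ^ (1 - κ - 1) : ℝ) : ℂ) u :=
      (Real.hasDerivAt_rpow_const (p := 1 - κ) (Or.inl hu.ne')).ofReal_comp
    have h2 := ee_deriv ((Real.hasDerivAt_log hu.ne').const_mul y)
    have h3 := (h1.mul h2).const_mul s⁻¹
    convert! h3 using 1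
    have e1 : (1 - κ - 1) = -κ := by ring
    have e2 : u ^ (1 - κ) = u ^ (-κ) * u := by
      rw [sub_eq_add_neg, Real.rpow_add hu, Real.rpow_one, mul_comm]
    rw [e1, e2]
    have hu' : (u:ℂ) ≠ 0 := by exact_mod_cast hu.ne'
    field_simp
    simp only [Int.cast_zero, zero_mul, sub_zero]
    rw [hs]
    push_cast
    field_simp
  have hpos : ∀ u ∈ uIcc a b, 0 < u := fun u hu => by
    rw [uIcc_of_le hab] at hu; linarith [hu.1]
  have hcont : ContinuousOn (fun u : ℝ => ((u ^ (-κ) : ℝ) : ℂ) * ee (y * Real.log u - ((0:ℤ):ℝ) * u)) (uIcc a b) := by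
    apply ContinuousOn.mul
    · apply Complex.continuous_ofReal.comp_continuousOn
      exact fun u hu => (rpow_hasDeriv κ u (hpos u hu)).continuousAt.continuousWithinAt
    · apply ee_cont.comp_continuousOn
      apply ContinuousOn.sub
      · exact continuousOn_const.mul (Real.continuousOn_log.mono fun u hu => (hpos u hu).ne')
      · fun_prop
  have := integral_eq_sub_of_hasDerivAt (fun u hu => hder u (hpos u hu)) hcont.intervalIntegrable
  unfold Tint
  rw [this]
  have nF : ∀ u : ℝ, 1 ≤ u → ‖Fp u‖ ≤ 1 / (2 * y) := by
    intro u hu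
    simp only [hF]
    rw [norm_mul, norm_mul, ee_norm, mul_one, Complex.norm_real, Real.norm_of_nonneg (by positivity), norm_inv]
    have h1 : u ^ (1 - κ) ≤ 1 := Real.rpow_le_one_of_one_le_of_nonpos hu (by linarith)
    have h2 : ‖s‖⁻¹ ≤ 1 / (2*y) := by rw [one_div]; exact inv_anti₀ (by linarith) hsn
    calc _ ≤ 1 / (2*y) * 1 := mul_le_mul h2 h1 (by positivity) (by positivity)
      _ = _ := mul_one _
  calc _ ≤ ‖Fp b‖ + ‖Fp a‖ := norm_sub_le _ _
    _ ≤ 1 / (2*y) + 1 / (2*y) := add_le_add (nF b (by linarith)) (nF a ha)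
    _ = 1 / y := by field_simp; norm_num

lemma zt_tail {κ y : ℝ} (hκ : 1 ≤ κ) (hy : 0 < y) (P Q : ℕ) (hP : 1 ≤ P) (hPQ : P ≤ Q) (hyP : 2 * y ≤ P) :
    ‖∑ m ∈ Finset.Ioc P Q, zt κ y m‖ ≤ (666 * (κ * (κ + 1) + 2)^2 + 1) * (1 / P) + 1 / y := by
  have hP' : (1:ℝ) ≤ P := by exact_mod_cast hP
  have hPQ' : (P:ℝ) ≤ Q := by exact_mod_cast hPQ
  have key := poisson (zphase y P Q hP hy hyP) (κ := κ) (by linarith) zero_le_one hP hPQ 0 (by norm_num)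
  have hI : Finset.Icc (-((0:ℕ):ℤ)) ((0:ℕ):ℤ) = {0} := by simp
  rw [hI, Finset.sum_singleton] at key
  have T0 := Tint_zero_bound hκ hy hP' hPQ'
  have hdiff : ∑ m ∈ Finset.Ioc P Q, zt κ y m = ∑ m ∈ Finset.Ico P Q, zt κ y m + zt κ y Q - zt κ y P := by
    have a1 := Finset.sum_Ioc_consecutive (fun m => zt κ y m) (Nat.zero_le P) hPQ
    have : ∀ (f : ℕ → ℂ), ∑ m ∈ Finset.Ioc P Q, f m = ∑ m ∈ Finset.Ico P Q, f m + f Q - f P := by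
      intro f
      have h1 : Finset.Icc P Q = insert P (Finset.Ioc P Q) := by
        ext x; simp only [Finset.mem_Icc, Finset.mem_insert, Finset.mem_Ioc]; omega
      have h2 : Finset.Icc P Q = insert Q (Finset.Ico P Q) := by
        ext x; simp only [Finset.mem_Icc, Finset.mem_insert, Finset.mem_Ico]; omega
      have h3 : ∑ m ∈ Finset.Icc P Q, f m = f P + ∑ m ∈ Finset.Ioc P Q, f m := by
        rw [h1, Finset.sum_insert (by simp)]
      have h4 : ∑ m ∈ Finset.Icc P Q, f m = f Q + ∑ m ∈ Finset.Ico P Q, f m := by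
        rw [h2, Finset.sum_insert (by simp)]
      linear_combination h4 - h3
    exact this _
  have eq : ∑ m ∈ Finset.Ioc P Q, zt κ y m
      = ((∑ m ∈ Finset.Ico P Q, zt κ y m + ∑ m ∈ Finset.Ioc P Q, zt κ y m)/2
          - Tint κ (fun u => y * Real.log u) P Q 0)
        + Tint κ (fun u => y * Real.log u) P Q 0 + (zt κ y Q - zt κ y P)/2 := by
    linear_combination (1/2 : ℂ) * hdiff
  have hr : ∀ m : ℕ, P ≤ m → (m:ℝ)^(-κ) ≤ 1 / P := by
    intro m hm
    have hm' : (P:ℝ) ≤ m := by exact_mod_cast hm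
    calc (m:ℝ)^(-κ) ≤ (P:ℝ)^(-κ) := Real.rpow_le_rpow_of_nonpos (by linarith) hm' (by linarith)
      _ ≤ (P:ℝ)^(-1:ℝ) := Real.rpow_le_rpow_of_exponent_le hP' (by linarith)
      _ = 1 / P := by rw [Real.rpow_neg_one, one_div]
  have hend : ‖(zt κ y Q - zt κ y P)/2‖ ≤ 1 / P := by
    rw [norm_div]
    have := norm_sub_le (zt κ y Q) (zt κ y P)
    rw [zt_norm, zt_norm] at this
    have h2 : ‖(2:ℂ)‖ = 2 := by simp
    rw [h2]
    linarith [hr Q hPQ, hr P le_rfl]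
  have key2 : ‖(∑ m ∈ Finset.Ico P Q, zt κ y m + ∑ m ∈ Finset.Ioc P Q, zt κ y m)/2
          - Tint κ (fun u => y * Real.log u) P Q 0‖ ≤ 666 * (κ * (κ + 1) + 2)^2 * (1/P) := by
    refine key.trans ?_
    have := hr P le_rfl
    have h0 : 0 ≤ (κ * (κ + 1) + 2)^2 := by positivity
    calc _ = 666 * (κ * (κ + 1) + 2)^2 * (P:ℝ)^(-κ) := by push_cast; ring
      _ ≤ _ := by gcongr
  rw [eq]
  refine (norm_add₃_le).trans ?_
  linarith

lemma zeta_trunc {κ y : ℝ} (hκ : 1 ≤ κ) (hy : 0 < y) (P : ℕ) (hP : 1 ≤ P) (hyP : 2 * y ≤ P) :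
    ‖riemannZeta (wz κ y) - ∑ m ∈ Finset.Ioc 0 P, zt κ y m‖
      ≤ (666 * ((κ+1) * (κ + 2) + 2)^2 + 1) * (1 / P) + 1 / y := by
  have step : ∀ k ∈ Ioc κ (κ+1), ‖riemannZeta (wz k y) - ∑ m ∈ Finset.Ioc 0 P, zt k y m‖
      ≤ (666 * ((κ+1) * (κ + 2) + 2)^2 + 1) * (1 / P) + 1 / y := by
    intro k hk
    have hk1 : 1 < k := lt_of_le_of_lt hκ hk.1
    have hre : 1 < (wz k y).re := by simpa [wz] using hk1
    have hsum : Summable (fun m : ℕ => zt k y m) := by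
      have := (Complex.summable_one_div_nat_cpow (p := wz k y)).2 hre
      refine this.congr ?_
      intro m; exact (zt_cpow k y (by linarith) m)
    have hz : riemannZeta (wz k y) = ∑' m, zt k y m := by
      rw [zeta_eq_tsum_one_div_nat_cpow hre]
      exact tsum_congr (fun m => zt_cpow k y (by linarith) m)
    have hHS : HasSum (fun m : ℕ => zt k y m) (riemannZeta (wz k y)) := by rw [hz]; exact hsum.hasSum
    have lim := (hHS.tendsto_sum_nat.sub_const (∑ m ∈ Finset.Ioc 0 P, zt k y m)).norm
    refine le_of_tendsto lim ?_
    filter_upwards [Filter.eventually_ge_atTop (P+1)] with R hR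
    obtain ⟨Q, rfl⟩ : ∃ Q, R = Q + 1 := ⟨R - 1, by omega⟩
    have e0 : zt k y 0 = 0 := by
      rw [← norm_eq_zero, zt_norm, Nat.cast_zero, Real.zero_rpow (by linarith)]
    have e1 : ∑ m ∈ Finset.range (Q+1), zt k y m = ∑ m ∈ Finset.Ioc 0 Q, zt k y m := by
      have : Finset.range (Q+1) = insert 0 (Finset.Ioc 0 Q) := by
        ext x; simp only [Finset.mem_range, Finset.mem_insert, Finset.mem_Ioc]; omega
      rw [this, Finset.sum_insert (by simp), e0, zero_add]
    rw [e1, ← Finset.sum_Ioc_consecutive (fun m => zt k y m) (Nat.zero_le P) (by omega : P ≤ Q), add_sub_cancel_left]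
    refine (zt_tail hk1.le hy P Q hP (by omega) hyP).trans ?_
    have hk2 := hk.2
    have : 0 < κ := by linarith
    have : 0 < k := by linarith
    have h1 : k * (k+1) ≤ (κ+1) * (κ+2) := by nlinarith
    gcongr
  have hne : wz κ y ≠ 1 := by
    intro h
    have := congrArg Complex.im h
    simp [wz] at this
    have := Real.pi_pos
    simp_all
  have cw : Continuous (fun k : ℝ => wz k y) := by unfold wz; fun_prop
  have c1 : Filter.Tendsto (fun k : ℝ => riemannZeta (wz k y)) (nhdsWithin κ (Ioi κ)) (nhds (riemannZeta (wz κ y))) :=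
    (((differentiableAt_riemannZeta hne).continuousAt.tendsto).comp cw.continuousAt.tendsto).mono_left nhdsWithin_le_nhds
  have c2 : Filter.Tendsto (fun k : ℝ => ∑ m ∈ Finset.Ioc 0 P, zt k y m) (nhdsWithin κ (Ioi κ)) (nhds (∑ m ∈ Finset.Ioc 0 P, zt κ y m)) := by
    refine Filter.Tendsto.mono_left ?_ nhdsWithin_le_nhds
    apply tendsto_finsetSum
    intro m hm
    have hm0 : (m:ℝ) ≠ 0 := by
      have := (Finset.mem_Ioc.1 hm).1
      exact_mod_cast this.ne'
    have : Continuous (fun k : ℝ => zt k y m) := by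
      unfold zt
      apply Continuous.mul _ continuous_const
      apply Complex.continuous_ofReal.comp
      exact Continuous.rpow continuous_const continuous_neg (fun _ => Or.inl hm0)
    exact this.tendsto κ
  refine le_of_tendsto (c1.sub c2).norm ?_
  filter_upwards [Ioc_mem_nhdsGT (by linarith : κ < κ + 1)] with k hk
  exact step k hk


lemma sum_inv_le (P : ℕ) (hP : 1 ≤ P) : ∑ m ∈ Finset.Ioc 0 P, (1 / (m:ℝ)) ≤ 1 + Real.log P := by
  have h := harmonic_le_one_add_log P
  rw [harmonic_eq_sum_Icc] at h
  push_cast at h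
  convert h using 1
  apply Finset.sum_congr
  · ext; simp [Nat.one_le_iff_ne_zero, Nat.pos_iff_ne_zero]
  · intro m _; rw [one_div]

lemma rpow_neg_le_inv {κ : ℝ} (hκ : 1 ≤ κ) (m : ℕ) (hm : 1 ≤ m) : (m:ℝ)^(-κ) ≤ 1 / m := by
  have hm' : (1:ℝ) ≤ m := by exact_mod_cast hm
  calc (m:ℝ)^(-κ) ≤ (m:ℝ)^(-1:ℝ) := Real.rpow_le_rpow_of_exponent_le hm' (by linarith)
      _ = 1 / m := by rw [Real.rpow_neg_one, one_div]

lemma sum_rpow_le {κ : ℝ} (hκ : 1 ≤ κ) (P : ℕ) (hP : 1 ≤ P) : ∑ m ∈ Finset.Ioc 0 P, (m:ℝ)^(-κ) ≤ 1 + Real.log P := by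
  refine (Finset.sum_le_sum ?_).trans (sum_inv_le P hP)
  intro m hm
  exact rpow_neg_le_inv hκ m (Finset.mem_Ioc.1 hm).1

lemma zt_triv {κ y : ℝ} (hκ : 1 ≤ κ) (P : ℕ) (hP : 1 ≤ P) : ‖∑ m ∈ Finset.Ioc 0 P, zt κ y m‖ ≤ 1 + Real.log P := by
  refine (norm_sum_le _ _).trans (le_trans (le_of_eq ?_) (sum_rpow_le hκ P hP))
  exact Finset.sum_congr rfl (fun m _ => zt_norm κ y m)

lemma lemmaA {κ d : ℝ} (hκ : 1 ≤ κ) (hd : 0 < d) : ∃ C > 0, ∀ n : ℕ, 1 ≤ n →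
    (∀ P : ℕ, ‖∑ m ∈ Finset.Ioc 0 P, zt κ (d * n) m‖ ≤ C * (n:ℝ)^(1/4:ℝ)) ∧
    ‖riemannZeta (wz κ (d * n))‖ ≤ C * (n:ℝ)^(1/4:ℝ) := by
  set C0 := (666 * ((κ+1) * (κ + 2) + 2)^2 + 1) with hC0
  have hC00 : 0 < C0 := by positivity
  have hL : 0 < Real.log (2 * d + 1) := Real.log_pos (by linarith)
  refine ⟨1 + Real.log (2*d+1) + 4 + C0 + 1 / d, by positivity, ?_⟩
  intro n hn
  have hn' : (1:ℝ) ≤ n := by exact_mod_cast hn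
  have hy : 0 < d * n := by positivity
  set P0 := ⌈2 * (d * n)⌉₊ with hP0
  have hP01 : 1 ≤ P0 := Nat.one_le_iff_ne_zero.2 (by rw [hP0]; exact (Nat.ceil_pos.2 (by positivity)).ne')
  have hP0r : (1:ℝ) ≤ P0 := by exact_mod_cast hP01
  have hle : 2 * (d * n) ≤ P0 := Nat.le_ceil _
  have hlt : (P0:ℝ) ≤ (2 * d + 1) * n := by
    have := (Nat.ceil_lt_add_one (by positivity : 0 ≤ 2 * (d * n))).le
    rw [← hP0] at this
    nlinarith
  have hlog : Real.log P0 ≤ Real.log (2 * d + 1) + 4 * (n:ℝ)^(1/4:ℝ) := by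
    calc Real.log P0 ≤ Real.log ((2 * d + 1) * n) := Real.log_le_log (by linarith) hlt
      _ = Real.log (2*d+1) + Real.log n := Real.log_mul (by positivity) (by positivity)
      _ ≤ _ := by
        have := Real.log_le_rpow_div (x := n) (by positivity) (ε := 1/4) (by norm_num)
        linarith
  have hn4 : 1 ≤ (n:ℝ)^(1/4:ℝ) := Real.one_le_rpow hn' (by norm_num)
  have hbase : 1 + Real.log P0 + (C0 * (1/P0) + 1/(d*n)) ≤ (1 + Real.log (2*d+1) + 4 + C0 + 1 / d) * (n:ℝ)^(1/4:ℝ) := by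
    have h1 : C0 * (1/P0) ≤ C0 := by
      have : 1 / (P0:ℝ) ≤ 1 := by rw [div_le_one (by linarith)]; exact hP0r
      nlinarith
    have h2 : 1/(d*n) ≤ 1/d := by
      apply one_div_le_one_div_of_le hd; nlinarith
    have h3 : 0 < 1 / d := by positivity
    nlinarith
  have hκ2 : (666 * (κ * (κ + 1) + 2)^2 + 1) ≤ C0 := by
    rw [hC0]
    have : κ * (κ+1) ≤ (κ+1) * (κ+2) := by nlinarith
    have : 0 < κ * (κ+1) := by positivity
    gcongr
  have hnn : 0 ≤ (C0 * (1/P0) + 1/(d*n)) := by positivity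
  have hlog0 : 0 ≤ Real.log P0 := Real.log_nonneg hP0r
  constructor
  · intro P
    rcases Nat.eq_zero_or_pos P with h0 | h0
    · subst h0
      rw [Finset.Ioc_self, Finset.sum_empty, norm_zero]
      linarith
    rcases le_total P P0 with h | h
    · refine (zt_triv hκ P h0).trans ?_
      have : Real.log P ≤ Real.log P0 := Real.log_le_log (by exact_mod_cast h0) (by exact_mod_cast h)
      linarith
    · rw [← Finset.sum_Ioc_consecutive (fun m => zt κ (d * n) m) (Nat.zero_le P0) h]
      refine (norm_add_le _ _).trans ?_
      have h1 := zt_triv (y := d * n) hκ P0 hP01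
      have h2 := zt_tail hκ hy P0 P hP01 h hle
      have h3 : (666 * (κ * (κ + 1) + 2)^2 + 1) * (1 / (P0:ℝ)) ≤ C0 * (1/P0) := by gcongr
      linarith
  · have h1 := zt_triv (y := d * n) hκ P0 hP01
    have h2 := zeta_trunc hκ hy P0 hP01 hle
    have h3 := norm_le_norm_sub_add (riemannZeta (wz κ (d * n))) (∑ m ∈ Finset.Ioc 0 P0, zt κ (d*n) m)
    linarith


noncomputable def psi (z : ℂ) : ℂ := (z - 1/2) * Complex.log z - z
noncomputable def rho (z : ℂ) : ℂ := (z + 1/2) * Complex.log (1 + 1/z) - 1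

lemma re_one_add_inv {z : ℂ} (hz : 0 < z.re) : 0 < (1 + 1/z).re := by
  rw [one_div, Complex.add_re, Complex.one_re, Complex.inv_re]
  have : 0 < Complex.normSq z := Complex.normSq_pos.2 (by rintro rfl; simp at hz)
  positivity

lemma log_add_one {z : ℂ} (hz : 0 < z.re) : Complex.log (z + 1) = Complex.log z + Complex.log (1 + 1/z) := by
  have hz0 : z ≠ 0 := by rintro rfl; simp at hz
  have h2 := re_one_add_inv hz
  have h20 : 1 + 1/z ≠ 0 := by intro h; rw [h] at h2; simp at h2
  have e : z + 1 = z * (1 + 1/z) := by field_simp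
  have a1 := abs_lt.1 (Complex.abs_arg_lt_pi_div_two_iff.2 (Or.inl hz))
  have a2 := abs_lt.1 (Complex.abs_arg_lt_pi_div_two_iff.2 (Or.inl h2))
  rw [e, Complex.log_mul hz0 h20 ⟨by linarith [a1.1, a2.1], by linarith [a1.2, a2.2]⟩]

lemma psi_step {z : ℂ} (hz : 0 < z.re) : psi (z + 1) - psi z = rho z + Complex.log z := by
  unfold psi rho
  rw [log_add_one hz]
  ring

lemma rho_bound {z : ℂ} (hz2 : 2 ≤ ‖z‖) : ‖rho z‖ ≤ 2 / ‖z‖^2 := by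
  have hz0 : z ≠ 0 := by rintro rfl; simp at hz2; linarith
  set v := 1/z with hv
  have hvn : ‖v‖ = 1/‖z‖ := by rw [hv, norm_div, norm_one]
  have hv1 : ‖v‖ ≤ 1/2 := by rw [hvn]; exact one_div_le_one_div_of_le two_pos hz2
  have hv0 : v ≠ 0 := by rw [hv]; exact one_div_ne_zero hz0
  have hvp : 0 < ‖v‖ := norm_pos_iff.2 hv0
  have hz : z = 1/v := by rw [hv, one_div_one_div]
  have key := Complex.norm_log_sub_logTaylor_le 2 (z := v) (by linarith)
  have hT : Complex.logTaylor (2+1) v = v - v^2/2 := by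
    simp [Complex.logTaylor, Finset.sum_range_succ]; ring
  rw [hT] at key
  set e := Complex.log (1 + v) - (v - v^2/2) with he
  have hr : rho z = -v^2/4 + e * (1/v) + e/2 := by
    unfold rho
    rw [← hv, hz]
    have : Complex.log (1 + v) = e + (v - v^2/2) := by rw [he]; ring
    rw [this]; field_simp; ring
  have hinv : (1 - ‖v‖)⁻¹ ≤ 2 := by
    rw [inv_le_comm₀ (by linarith) two_pos]; linarith
  have he1 : ‖e‖ ≤ ‖v‖^3 := by
    refine key.trans ?_
    have : ‖v‖^3 * (1 - ‖v‖)⁻¹ ≤ ‖v‖^3 * 2 := by gcongr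
    norm_num
    nlinarith [pow_pos hvp 3]
  rw [hr]
  have n1 : ‖-v^2/4‖ = ‖v‖^2/4 := by simp
  have n2 : ‖e * (1/v)‖ ≤ ‖v‖^2 := by
    rw [norm_mul, norm_div, norm_one, mul_one_div, div_le_iff₀ hvp]
    calc _ ≤ _ := he1
      _ = _ := by ring
  have n3 : ‖e/2‖ ≤ ‖v‖^2/2 := by
    rw [norm_div]
    have h2 : ‖(2:ℂ)‖ = 2 := by simp
    rw [h2]
    nlinarith [pow_pos hvp 2]
  calc _ ≤ _ := norm_add₃_le
    _ ≤ ‖v‖^2/4 + ‖v‖^2 + ‖v‖^2/2 := by rw [n1]; gcongr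
    _ ≤ 2 * ‖v‖^2 := by nlinarith [pow_pos hvp 2]
    _ = _ := by rw [hvn]; field_simp

lemma prod_eq {z : ℂ} (hz : 0 < z.re) (k : ℕ) :
    ∏ j ∈ Finset.range k, (z + j) = Complex.exp (psi (z + k) - psi z - ∑ j ∈ Finset.range k, rho (z + j)) := by
  induction k with
  | zero => simp
  | succ k ih =>
    have hk : 0 < (z + k).re := by simp; positivity
    have hk0 : z + k ≠ 0 := by intro h; rw [h] at hk; simp at hk
    rw [Finset.prod_range_succ, ih, Finset.sum_range_succ]
    conv_lhs => rw [← Complex.exp_log hk0]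
    rw [Complex.exp_log hk0] 
    nth_rewrite 2 [← Complex.exp_log hk0]
    rw [← Complex.exp_add]
    congr 1
    have := psi_step hk
    push_cast
    rw [← add_assoc]
    linear_combination -this

lemma an_tendsto {z : ℂ} (hz : 0 < z.re) :
    Filter.Tendsto (fun n : ℕ => (n:ℂ)^z * n.factorial * Complex.exp (-psi (z + (n+1 : ℕ)))) Filter.atTop
      (nhds ((Real.sqrt (2 * Real.pi) : ℝ) : ℂ)) := by
  have t1 : Filter.Tendsto (fun n : ℕ => (n:ℂ) * ((z+1)/(n:ℂ))) Filter.atTop (nhds (z+1)) := by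
    refine tendsto_const_nhds.congr' ?_
    filter_upwards [Filter.eventually_ge_atTop 1] with n hn
    have : (n:ℂ) ≠ 0 := by exact_mod_cast (by omega : n ≠ 0)
    field_simp
  have t2 := Complex.tendsto_nat_mul_log_one_add_of_tendsto t1
  have t0 : Filter.Tendsto (fun n : ℕ => ((n:ℂ))⁻¹) Filter.atTop (nhds 0) := tendsto_inv_atTop_nhds_zero_nat (𝕜 := ℂ)
  have t3 : Filter.Tendsto (fun n : ℕ => Complex.log (1 + (z+1)/(n:ℂ))) Filter.atTop (nhds 0) := by
    have := t2.mul t0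
    rw [mul_zero] at this
    refine this.congr' ?_
    filter_upwards [Filter.eventually_ge_atTop 1] with n hn
    have : (n:ℂ) ≠ 0 := by exact_mod_cast (by omega : n ≠ 0)
    field_simp
  have t4 : Filter.Tendsto (fun n : ℕ => Complex.exp ((z+1) - (n * Complex.log (1 + (z+1)/(n:ℂ))
      + (z + 1/2) * Complex.log (1 + (z+1)/(n:ℂ))))) Filter.atTop (nhds 1) := by
    have := (tendsto_const_nhds (x := z+1)).sub (t2.add (t3.const_mul (z+1/2)))
    rw [mul_zero, add_zero, sub_self] at this
    have h := (Complex.continuous_exp.tendsto 0).comp this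
    rw [Complex.exp_zero] at h
    exact h
  have t5 : Filter.Tendsto (fun n : ℕ => ((Stirling.stirlingSeq n * Real.sqrt 2 : ℝ) : ℂ)) Filter.atTop
      (nhds ((Real.sqrt Real.pi * Real.sqrt 2 : ℝ) : ℂ)) :=
    (Complex.continuous_ofReal.tendsto _).comp (Stirling.tendsto_stirlingSeq_sqrt_pi.mul_const _)
  have t6 := t5.mul t4
  have e0 : Real.sqrt (2 * Real.pi) = Real.sqrt Real.pi * Real.sqrt 2 := by
    rw [Real.sqrt_mul (by norm_num), mul_comm]
  rw [e0]
  rw [mul_one] at t6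
  refine t6.congr' ?_
  filter_upwards [Filter.eventually_ge_atTop 1] with n hn
  have hn0 : (n:ℂ) ≠ 0 := by exact_mod_cast (by omega : n ≠ 0)
  have hnr : (0:ℝ) < n := by exact_mod_cast (by omega : 0 < n)
  have hfac : (n.factorial : ℂ) = ((Stirling.stirlingSeq n * Real.sqrt 2 : ℝ) : ℂ)
      * Complex.exp (1/2 * Complex.log n) * Complex.exp (n * Complex.log n - n) := by
    have hr : (n.factorial : ℝ) = Stirling.stirlingSeq n * Real.sqrt 2 * Real.exp (1/2 * Real.log n) * Real.exp (n * Real.log n - n) := by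
      unfold Stirling.stirlingSeq
      have h1 : Real.sqrt (2 * n) = Real.sqrt 2 * Real.exp (1/2 * Real.log n) := by
        rw [Real.sqrt_mul (by norm_num), Real.sqrt_eq_rpow n, Real.rpow_def_of_pos hnr, mul_comm (Real.log (n:ℝ))]
      have h2 : ((n:ℝ) / Real.exp 1)^n = Real.exp (n * Real.log n - n) := by
        rw [div_pow, ← Real.exp_nat_mul, mul_one, Real.exp_sub, Real.exp_nat_mul, Real.exp_log hnr]
      rw [h1, h2]
      have := Real.exp_pos (1/2 * Real.log n)
      have := Real.exp_pos (n * Real.log n - n)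
      have : Real.sqrt 2 ≠ 0 := by positivity
      field_simp
    have : (n.factorial : ℂ) = ((n.factorial : ℝ) : ℂ) := by push_cast; rfl
    rw [this, hr]
    push_cast
    rfl
  have hlog : Complex.log (z + (n+1 : ℕ)) = Complex.log n + Complex.log (1 + (z+1)/(n:ℂ)) := by
    have e1 : z + (n+1 : ℕ) = ((n:ℝ):ℂ) * (1 + (z+1)/(n:ℂ)) := by
      push_cast; field_simp; ring
    have hne : (1 + (z+1)/(n:ℂ)) ≠ 0 := by
      intro h
      rw [h, mul_zero] at e1
      have := congrArg Complex.re e1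
      simp at this
      linarith
    rw [e1, Complex.log_ofReal_mul hnr hne, Complex.ofReal_log hnr.le]
    push_cast; rfl
  rw [Complex.cpow_def_of_ne_zero hn0, hfac]
  have hpsi : -psi (z + (n+1 : ℕ)) = -((z + n + 1/2) * (Complex.log n + Complex.log (1 + (z+1)/(n:ℂ)))) + z + n + 1 := by
    unfold psi; rw [hlog]; push_cast; ring
  rw [hpsi]
  have : ∀ a b c d' s : ℂ, Complex.exp a * (s * Complex.exp b * Complex.exp c) * Complex.exp d' = s * Complex.exp (a + b + c + d') := by
    intro a b c d' s; rw [Complex.exp_add, Complex.exp_add, Complex.exp_add]; ring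
  rw [this]
  congr 2
  ring

lemma stirling {κ t : ℝ} (hκ : 1 ≤ κ) (ht : 4 ≤ t) :
    ‖Complex.Gamma ((κ:ℂ) - t * Complex.I) * Complex.exp (-psi ((κ:ℂ) - t * Complex.I)) - ((Real.sqrt (2 * Real.pi) : ℝ) : ℂ)‖
      ≤ Real.sqrt (2 * Real.pi) * (8 / t) := by
  set z : ℂ := (κ:ℂ) - t * Complex.I with hzdef
  have hzre : z.re = κ := by simp [hzdef]
  have hz : 0 < z.re := by rw [hzre]; linarith
  have hS : ∀ k : ℕ, ‖∑ j ∈ Finset.range k, rho (z + j)‖ ≤ 4 / t := by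
    intro k
    have hj : ∀ j : ℕ, ‖rho (z + j)‖ ≤ 4 * (1 / ((j:ℝ) + t) - 1 / (((j+1 : ℕ):ℝ) + t)) := by
      intro j
      have hre : (z + j).re = κ + j := by simp [hzre]
      have him : (z + j).im = -t := by simp [hzdef]
      have hsq : ‖z + j‖^2 = (κ + j)^2 + t^2 := by
        rw [← Complex.normSq_eq_norm_sq, Complex.normSq_apply, hre, him]; ring
      have hj0 : (0:ℝ) ≤ j := by positivity
      have h2 : 2 ≤ ‖z + j‖ := by
        have := Complex.abs_im_le_norm (z + j)
        rw [him, abs_neg, abs_of_pos (by linarith)] at this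
        linarith
      refine (rho_bound h2).trans ?_
      rw [hsq]
      push_cast
      have e : 4 * (1 / ((j:ℝ) + t) - 1 / ((j:ℝ) + 1 + t)) = 4 / ((j + t) * (j + 1 + t)) := by
        field_simp; ring
      rw [e, div_le_div_iff₀ (by positivity) (by positivity)]
      nlinarith [sq_nonneg (κ + j - t), sq_nonneg (κ - 1), mul_nonneg hj0 (by linarith : 0 ≤ κ - 1), mul_nonneg (by linarith : 0 ≤ t) (by linarith : 0 ≤ κ - 1)]
    refine (norm_sum_le _ _).trans ((Finset.sum_le_sum (fun j _ => hj j)).trans ?_)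
    rw [← Finset.mul_sum, Finset.sum_range_sub' (fun j : ℕ => 1 / ((j:ℝ) + t))]
    have : 0 ≤ 1 / ((k:ℝ) + t) := by positivity
    calc _ ≤ 4 * (1 / t) := by
          have e : 1 / (((0:ℕ):ℝ) + t) = 1 / t := by simp
          rw [e]; linarith
      _ = 4 / t := by ring
  have la := an_tendsto hz
  have lg := (Complex.GammaSeq_tendsto_Gamma z).mul_const (Complex.exp (-psi z))
  have ld := (lg.sub la).norm
  refine le_of_tendsto_of_tendsto ld (la.norm.mul_const (8/t) |>.trans (by
    rw [Complex.norm_real, Real.norm_of_nonneg (by positivity)])) ?_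
  refine Filter.Eventually.of_forall ?_
  intro n
  have hG : Complex.GammaSeq z n * Complex.exp (-psi z) = (n:ℂ)^z * n.factorial * Complex.exp (-psi (z + (n+1 : ℕ)))
      * Complex.exp (∑ j ∈ Finset.range (n+1), rho (z + j)) := by
    unfold Complex.GammaSeq
    rw [prod_eq hz, div_eq_mul_inv, ← Complex.exp_neg, mul_assoc, ← Complex.exp_add, mul_assoc ((n:ℂ)^z * n.factorial), ← Complex.exp_add]
    congr 2
    ring
  simp only
  rw [hG, ← mul_sub_one, norm_mul]
  gcongr
  have h1 := hS (n+1)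
  have h2 : 4 / t ≤ 1 := by rw [div_le_one (by linarith)]; exact ht
  refine (Complex.norm_exp_sub_one_le (h1.trans h2)).trans ?_
  calc _ ≤ 2 * (4/t) := by gcongr
    _ = 8 / t := by ring


noncomputable def Mn (κ y : ℝ) : ℂ :=
  Complex.exp (2 * (Real.pi : ℂ) * Complex.I / 8) * ((y ^ (κ - 1/2) : ℝ) : ℂ) * ee (y * (1 - Real.log y))

noncomputable def chi (z : ℂ) : ℂ :=
  2 * (2 * (Real.pi:ℂ)) ^ (-z) * Complex.Gamma z * Complex.cos ((Real.pi:ℂ) * z / 2)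

lemma log_w {κ t : ℝ} (hκ : 1 ≤ κ) (ht : 0 < t) :
    Complex.log ((κ:ℂ) - t * Complex.I) = (Real.log t : ℂ) - (Real.pi:ℂ)/2 * Complex.I + Complex.log (1 + Complex.I * κ / t) := by
  have ht0 : (t:ℂ) ≠ 0 := by exact_mod_cast ht.ne'
  have e : (κ:ℂ) - t * Complex.I = (t:ℂ) * (-Complex.I * (1 + Complex.I * κ / t)) := by
    field_simp
    linear_combination (κ:ℂ) * Complex.I_sq
  have hre : 0 < (1 + Complex.I * κ / t).re := by
    have : (1 + Complex.I * κ / t).re = 1 := by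
      rw [mul_div_assoc, ← Complex.ofReal_div]; simp [-Complex.ofReal_div]
    rw [this]; norm_num
  have him : 0 ≤ (1 + Complex.I * κ / t).im := by
    have : (1 + Complex.I * κ / t).im = κ / t := by
      rw [mul_div_assoc, ← Complex.ofReal_div]; simp [-Complex.ofReal_div]
    rw [this]; positivity
  have hne : (1 + Complex.I * κ / t) ≠ 0 := by intro h; rw [h] at hre; simp at hre
  have a2 := abs_lt.1 (Complex.abs_arg_lt_pi_div_two_iff.2 (Or.inl hre))
  have hpi := Real.pi_pos
  rw [e, Complex.log_ofReal_mul ht (mul_ne_zero (neg_ne_zero.2 Complex.I_ne_zero) hne),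
    Complex.log_mul (neg_ne_zero.2 Complex.I_ne_zero) hne (by
      rw [Complex.arg_neg_I]
      exact ⟨by linarith [a2.1], by linarith [a2.2]⟩), Complex.log_neg_I]
  ring

lemma chi_id {κ y : ℝ} (hκ : 1 ≤ κ) (hy : 0 < y) {t : ℝ} (ht : t = 2 * Real.pi * y) {z : ℂ} (hz : z = (κ:ℂ) - t * Complex.I) :
    2 * (2 * (Real.pi:ℂ)) ^ (-z) * Complex.cos ((Real.pi:ℂ) * z / 2) * Complex.exp (psi z) * ((Real.sqrt (2 * Real.pi) : ℝ) : ℂ)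
     = Mn κ y * Complex.exp ((z - 1/2) * Complex.log (1 + Complex.I * κ / t) - κ)
        * (1 + Complex.exp (-(Complex.I * Real.pi * z))) := by
  have hpi := Real.pi_pos
  have h2pi : (0:ℝ) < 2 * Real.pi := by positivity
  have ht0 : 0 < t := by rw [ht]; positivity
  set L : ℝ := Real.log (2 * Real.pi) with hL
  have e1 : (2 * (Real.pi:ℂ)) ^ (-z) = Complex.exp (L * (-z)) := by
    have : (2 * (Real.pi:ℂ)) = ((2 * Real.pi : ℝ) : ℂ) := by push_cast; rfl
    rw [this, Complex.cpow_def_of_ne_zero (by exact_mod_cast h2pi.ne'), ← Complex.ofReal_log h2pi.le]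
  have e2 : ((Real.sqrt (2 * Real.pi) : ℝ) : ℂ) = Complex.exp (L * (1/2)) := by
    rw [Real.sqrt_eq_rpow, Real.rpow_def_of_pos h2pi]
    push_cast; rfl
  have e3 : ((y ^ (κ - 1/2) : ℝ) : ℂ) = Complex.exp (Real.log y * (κ - 1/2)) := by
    rw [Real.rpow_def_of_pos hy]; push_cast; rfl
  have e4 : Complex.cos ((Real.pi:ℂ) * z / 2) = Complex.exp (Complex.I * Real.pi * z / 2) * (1 + Complex.exp (-(Complex.I * Real.pi * z))) / 2 := by
    rw [Complex.cos, mul_add, mul_one, ← Complex.exp_add]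
    congr 3
    · ring
    · ring
  have e5 : psi z = (z - 1/2) * ((L + Real.log y : ℂ) - (Real.pi:ℂ)/2 * Complex.I + Complex.log (1 + Complex.I * κ / t)) - z := by
    unfold psi
    rw [hz, log_w hκ ht0]
    have : Real.log t = L + Real.log y := by rw [ht, Real.log_mul h2pi.ne' hy.ne']
    rw [this]; push_cast; rfl
  unfold Mn ee
  rw [e1, e2, e3, e4, e5]
  have g1 : ∀ a b c e s : ℂ, 2 * Complex.exp a * (Complex.exp b * s / 2) * Complex.exp c * Complex.exp e = Complex.exp (a+b+c+e) * s := by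
    intro a b c e s; rw [Complex.exp_add, Complex.exp_add, Complex.exp_add]; ring
  rw [g1, ← Complex.exp_add, ← Complex.exp_add, ← Complex.exp_add]
  congr 2
  have ht' : (t:ℂ) = 2 * Real.pi * y := by rw [ht]; push_cast; rfl
  push_cast
  rw [hz]
  linear_combination (Complex.I * (1 - Real.log y)) * ht'

lemma chi_bound {κ y : ℝ} (hκ : 1 ≤ κ) (hy : 3 * κ^2 + 8 ≤ y) :
    ‖chi (wz κ y) - Mn κ y‖ ≤ (24 * κ^2 + 10) * y ^ (κ - 3/2) := by
  have hpi := Real.pi_gt_three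
  have hy0 : 0 < y := by nlinarith
  obtain ⟨t, ht⟩ : ∃ t : ℝ, t = 2 * Real.pi * y := ⟨_, rfl⟩
  obtain ⟨z, hz⟩ : ∃ z : ℂ, z = (κ:ℂ) - t * Complex.I := ⟨_, rfl⟩
  have hyt : y ≤ t := by rw [ht]; nlinarith
  have ht0 : 0 < t := by linarith
  have htc : (t:ℂ) ≠ 0 := by exact_mod_cast ht0.ne'
  have hw : wz κ y = z := by rw [hz, ht]; unfold wz; push_cast; ring
  have id := chi_id hκ hy0 ht hz
  have st := stirling hκ (t := t) (by nlinarith)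
  rw [← hz] at st
  set s2 : ℝ := Real.sqrt (2 * Real.pi) with hs2
  have hs0 : 0 < s2 := by positivity
  have hs0c : (s2:ℂ) ≠ 0 := by exact_mod_cast hs0.ne'
  set r : ℂ := (z - 1/2) * Complex.log (1 + Complex.I * κ / t) - κ with hr
  set δ : ℂ := Complex.exp (-(Complex.I * Real.pi * z)) with hδ
  set q : ℂ := Complex.Gamma z * Complex.exp (-psi z) / s2 with hq
  have hq1 : ‖q - 1‖ ≤ 8 / t := by
    have : q - 1 = (Complex.Gamma z * Complex.exp (-psi z) - s2) / s2 := by rw [hq]; field_simp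
    rw [this, norm_div, Complex.norm_real, Real.norm_of_nonneg hs0.le, div_le_iff₀ hs0]
    linarith
  have hchi : chi (wz κ y) = Mn κ y * (Complex.exp r * (1 + δ) * q) := by
    have : Mn κ y * (Complex.exp r * (1 + δ) * q) = (Mn κ y * Complex.exp r * (1 + δ)) * q := by ring
    rw [this, ← id, hw, hq]
    unfold chi
    have e := Complex.exp_neg (psi z)
    rw [e]
    have := Complex.exp_ne_zero (psi z)
    field_simp
  have hδn : ‖δ‖ ≤ 1 / t := by
    rw [hδ, Complex.norm_exp]
    have : (-(Complex.I * Real.pi * z)).re = -(Real.pi * t) := by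
      rw [hz]; simp
    rw [this, Real.exp_neg, one_div]
    apply inv_anti₀ ht0
    have := Real.add_one_le_exp (Real.pi * t)
    nlinarith
  set v : ℂ := Complex.I * κ / t with hv
  have hvn : ‖v‖ = κ / t := by
    rw [hv]; simp [abs_of_pos ht0, abs_of_pos (by linarith : 0 < κ)]
  have hv2 : ‖v‖ ≤ 1/2 := by
    rw [hvn, div_le_iff₀ ht0]; nlinarith
  have hle := Complex.norm_log_one_add_sub_self_le (z := v) (by linarith)
  set e := Complex.log (1 + v) - v with he
  have hen : ‖e‖ ≤ ‖v‖^2 := by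
    refine hle.trans ?_
    have : (1 - ‖v‖)⁻¹ ≤ 2 := by rw [inv_le_comm₀ (by linarith) two_pos]; linarith
    have h2 : 0 ≤ ‖v‖^2 := by positivity
    nlinarith
  have hrr : r = (κ - 1/2) * v + (z - 1/2) * e := by
    have : Complex.log (1 + v) = v + e := by rw [he]; ring
    rw [hr, this, hz]
    have h3 : t * Complex.I * v = - κ := by
      rw [hv]; field_simp; linear_combination (κ:ℂ) * Complex.I_sq
    linear_combination -h3
  have hrn : ‖r‖ ≤ 3 * κ^2 / t := by
    rw [hrr]
    have n1 : ‖((κ:ℂ) - 1/2)‖ ≤ κ := by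
      have : ((κ:ℂ) - 1/2) = ((κ - 1/2 : ℝ) : ℂ) := by push_cast; rfl
      rw [this, Complex.norm_real, Real.norm_of_nonneg (by linarith)]; linarith
    have n2 : ‖z - 1/2‖ ≤ κ + t := by
      have : z - 1/2 = ((κ:ℂ) - 1/2) - t * Complex.I := by rw [hz]; ring
      rw [this]
      refine (norm_sub_le _ _).trans ?_
      have : ‖(t:ℂ) * Complex.I‖ = t := by simp [abs_of_pos ht0]
      linarith
    have n3 : κ + t ≤ 3/2 * t := by nlinarith
    calc _ ≤ ‖((κ:ℂ) - 1/2) * v‖ + ‖(z - 1/2) * e‖ := norm_add_le _ _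
      _ ≤ κ * (κ / t) + (3/2 * t) * (κ / t)^2 := by
          rw [norm_mul, norm_mul, ← hvn]
          gcongr
          exact n2.trans n3
      _ = (5/2) * κ^2 / t := by field_simp; ring
      _ ≤ _ := by gcongr; norm_num
  have hr1 : 3 * κ^2 / t ≤ 1 := by rw [div_le_one ht0]; linarith
  have ha : ‖Complex.exp r - 1‖ ≤ 6 * κ^2 / t := by
    refine (Complex.norm_exp_sub_one_le (hrn.trans hr1)).trans ?_
    calc _ ≤ 2 * (3 * κ^2 / t) := by gcongr
      _ = _ := by ring
  have hb1 : 1 / t ≤ 1 := by rw [div_le_one ht0]; nlinarith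
  have hc1 : 8 / t ≤ 1 := by rw [div_le_one ht0]; nlinarith
  have main : ‖Complex.exp r * (1 + δ) * q - 1‖ ≤ (24 * κ^2 + 10) / t := by
    have : Complex.exp r * (1 + δ) * q - 1 = (Complex.exp r - 1) * ((1 + δ) * (1 + (q - 1))) + (δ * (1 + (q - 1)) + (q - 1)) := by ring
    rw [this]
    have m1 : ‖1 + δ‖ ≤ 2 := (norm_add_le _ _).trans (by rw [norm_one]; linarith)
    have m2 : ‖1 + (q - 1)‖ ≤ 2 := (norm_add_le _ _).trans (by rw [norm_one]; linarith)
    calc _ ≤ ‖(Complex.exp r - 1) * ((1 + δ) * (1 + (q - 1)))‖ + (‖δ * (1 + (q - 1))‖ + ‖q - 1‖) :=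
          (norm_add_le _ _).trans (by gcongr; exact norm_add_le _ _)
      _ ≤ (6 * κ^2 / t) * (2 * 2) + ((1/t) * 2 + 8/t) := by
          rw [norm_mul, norm_mul, norm_mul]; gcongr
      _ = _ := by ring
  have hMn : ‖Mn κ y‖ = y ^ (κ - 1/2) := by
    unfold Mn
    rw [norm_mul, norm_mul, ee_norm, Complex.norm_real, Real.norm_of_nonneg (by positivity)]
    have : ‖Complex.exp (2 * (Real.pi : ℂ) * Complex.I / 8)‖ = 1 := by
      rw [Complex.norm_exp]; simp
    rw [this]; ring
  have hsplit : y ^ (κ - 3/2) = y ^ (κ - 1/2) * (1 / y) := by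
    have : κ - 3/2 = (κ - 1/2) - 1 := by ring
    rw [this, Real.rpow_sub hy0, Real.rpow_one]; ring
  rw [hchi, ← mul_sub_one, norm_mul, hMn, hsplit]
  calc _ ≤ y ^ (κ - 1/2) * ((24 * κ^2 + 10) / t) := by gcongr
    _ ≤ y ^ (κ - 1/2) * ((24 * κ^2 + 10) / y) := by gcongr
    _ = _ := by ring

lemma chi_all {κ d : ℝ} (hκ : 1 ≤ κ) (hd : 0 < d) : ∃ C > 0, ∀ n : ℕ, 1 ≤ n →
    ‖chi (wz κ (d * n)) - Mn κ (d * n)‖ ≤ C * (n:ℝ) ^ (κ - 3/2) := by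
  obtain ⟨N0, hN0⟩ := exists_nat_ge ((3 * κ^2 + 8) / d)
  set S := ∑ n ∈ Finset.range N0, ‖chi (wz κ (d * n)) - Mn κ (d * n)‖ / (n:ℝ) ^ (κ - 3/2) with hS
  have hS0 : 0 ≤ S := Finset.sum_nonneg (fun n _ => by positivity)
  refine ⟨(24 * κ^2 + 10) * d ^ (κ - 3/2) + S, by positivity, ?_⟩
  intro n hn
  have hn' : (0:ℝ) < n := by exact_mod_cast hn
  have hp : 0 < (n:ℝ) ^ (κ - 3/2) := by positivity
  rcases lt_or_ge n N0 with h | h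
  · have := Finset.single_le_sum (f := fun n : ℕ => ‖chi (wz κ (d * n)) - Mn κ (d * n)‖ / (n:ℝ) ^ (κ - 3/2))
      (fun n _ => by positivity) (Finset.mem_range.2 h)
    rw [← hS, div_le_iff₀ hp] at this
    refine this.trans ?_
    have : 0 ≤ (24 * κ^2 + 10) * d ^ (κ - 3/2) := by positivity
    gcongr; linarith
  · have h2 : 3 * κ^2 + 8 ≤ d * n := by
      have : (N0:ℝ) ≤ n := by exact_mod_cast h
      have := hN0.trans this
      rw [div_le_iff₀ hd] at this
      linarith
    refine (chi_bound hκ h2).trans ?_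
    rw [Real.mul_rpow hd.le hn'.le, ← mul_assoc]
    gcongr; linarith

lemma zeta_fe {σ d : ℝ} (hσ : σ ≤ 0) (hd : 0 < d) (n : ℕ) (hn : 1 ≤ n) :
    riemannZeta ((σ : ℂ) + 2 * (Real.pi : ℂ) * Complex.I * (d : ℂ) * (n : ℂ))
      = chi (wz (1 - σ) (d * n)) * riemannZeta (wz (1 - σ) (d * n)) := by
  have hn' : (0:ℝ) < n := by exact_mod_cast hn
  have him : (wz (1 - σ) (d * n)).im ≠ 0 := by
    have : (wz (1 - σ) (d * n)).im = -(2 * Real.pi * (d * n)) := by simp [wz]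
    rw [this]
    have := Real.pi_pos
    exact neg_ne_zero.2 (by positivity)
  have e : (σ : ℂ) + 2 * (Real.pi : ℂ) * Complex.I * (d : ℂ) * (n : ℂ) = 1 - wz (1 - σ) (d * n) := by
    unfold wz; push_cast; ring
  rw [e, riemannZeta_one_sub (fun k h => him (by rw [h]; simp)) (fun h => him (by rw [h]; simp))]
  rfl




lemma Fm_eq {d θ : ℝ} (hd : 0 < d) {m : ℕ} (hm : 1 ≤ m) {u : ℝ} (hu : 0 < u) :
    Fm d θ m u = d * u * (1 + Real.log m - Real.log d - Real.log u) + θ * u := by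
  have hm' : (0:ℝ) < m := by exact_mod_cast hm
  unfold Fm
  rw [Real.log_div (by positivity) (by positivity), Real.log_mul (by positivity) (by positivity), Real.log_exp,
    Real.log_mul hd.ne' hu.ne']
  ring

lemma Fm_deriv {d θ : ℝ} (hd : 0 < d) {m : ℕ} (hm : 1 ≤ m) {u : ℝ} (hu : 0 < u) :
    HasDerivAt (Fm d θ m) (d * (Real.log m - Real.log d - Real.log u) + θ) u := by
  have h1 : HasDerivAt (fun u : ℝ => d * u * (1 + Real.log m - Real.log d - Real.log u) + θ * u)
      (d * (Real.log m - Real.log d - Real.log u) + θ) u := by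
    have a := ((hasDerivAt_id u).const_mul d).mul ((Real.hasDerivAt_log hu.ne').const_sub (1 + Real.log m - Real.log d))
    have b := a.add ((hasDerivAt_id u).const_mul θ)
    convert! b using 1
    simp only [id]
    field_simp
    ring
  refine h1.congr_of_eventuallyEq ?_
  filter_upwards [lt_mem_nhds hu] with v hv
  exact Fm_eq hd hm hv

noncomputable def fphase {d θ : ℝ} (hd : 0 < d) {m : ℕ} (hm : 1 ≤ m) {a b Λ : ℝ} (ha : 1 ≤ a)
    (hΛ : ∀ u ∈ Icc a b, |Real.log m - Real.log u| ≤ Λ) :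
    PhaseB (Fm d θ m) a b (d * (Λ + |Real.log d|) + |θ|) d where
  g1 := fun u => d * (Real.log m - Real.log d - Real.log u) + θ
  g2 := fun u => d * (-u⁻¹)
  g3 := fun u => d * (u^2)⁻¹
  h1 := fun u hu => Fm_deriv hd hm hu
  h2 := fun u hu => (((Real.hasDerivAt_log hu.ne').const_sub _).const_mul d).add_const _
  h3 := fun u hu => by
    have h := ((hasDerivAt_inv hu.ne').neg).const_mul d
    convert! h using 1
    ring
  c3 := by
    apply continuousOn_const.mul
    apply ContinuousOn.inv₀ (by fun_prop)
    intro u hu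
    exact pow_ne_zero 2 (ne_of_gt hu)
  b1 := fun u hu => by
    have h := hΛ u hu
    calc _ ≤ |d * (Real.log m - Real.log d - Real.log u)| + |θ| := abs_add_le _ _
      _ ≤ _ := by
        rw [abs_mul, abs_of_pos hd]
        have : |Real.log m - Real.log d - Real.log u| ≤ Λ + |Real.log d| := by
          have e : Real.log m - Real.log d - Real.log u = (Real.log m - Real.log u) - Real.log d := by ring
          rw [e]
          exact (abs_sub _ _).trans (by linarith)
        gcongr
  b2 := fun u hu => by
    have hu0 : 0 < u := by linarith [hu.1]
    rw [mul_neg, abs_neg, abs_of_pos (by positivity), div_eq_mul_inv]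
  b3 := fun u hu => by
    have hu0 : 0 < u := by linarith [hu.1]
    rw [abs_of_pos (by positivity), div_eq_mul_inv]

noncomputable def fm (d θ : ℝ) (m n : ℕ) : ℂ := (((n:ℝ) ^ (-(1/2:ℝ)) : ℝ) : ℂ) * ee (Fm d θ m n)

noncomputable def an (d θ : ℝ) (n : ℕ) : ℂ :=
  (((n:ℝ) ^ (-(1/2:ℝ)) : ℝ) : ℂ) * ee (θ * n + d * n * (1 - Real.log (d * n)))

lemma fm_norm (d θ : ℝ) (m n : ℕ) : ‖fm d θ m n‖ = (n:ℝ) ^ (-(1/2:ℝ)) := by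
  unfold fm; rw [norm_mul, ee_norm, mul_one, Complex.norm_real, Real.norm_of_nonneg (by positivity)]

lemma an_norm (d θ : ℝ) (n : ℕ) : ‖an d θ n‖ = (n:ℝ) ^ (-(1/2:ℝ)) := by
  unfold an; rw [norm_mul, ee_norm, mul_one, Complex.norm_real, Real.norm_of_nonneg (by positivity)]

lemma half_le_one (n : ℕ) (hn : 1 ≤ n) : (n:ℝ) ^ (-(1/2:ℝ)) ≤ 1 :=
  Real.rpow_le_one_of_one_le_of_nonpos (by exact_mod_cast hn) (by norm_num)

lemma an_zt {d θ : ℝ} (hd : 0 < d) (κ : ℝ) {m n : ℕ} (hm : 1 ≤ m) (hn : 1 ≤ n) :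
    an d θ n * zt κ (d * n) m = (((m:ℝ) ^ (-κ) : ℝ) : ℂ) * fm d θ m n := by
  have hn' : (0:ℝ) < n := by exact_mod_cast hn
  unfold an zt fm
  rw [Fm_eq hd hm hn', Real.log_mul hd.ne' hn'.ne']
  have : d * n * (1 + Real.log m - Real.log d - Real.log n) + θ * n
    = (θ * n + d * n * (1 - (Real.log d + Real.log n))) + d * n * Real.log m := by ring
  rw [this, ee_add (θ * n + d * n * (1 - (Real.log d + Real.log n)))]
  ring

lemma swap_sum {d θ : ℝ} (hd : 0 < d) (κ : ℝ) (S T : Finset ℕ) (hS : ∀ n ∈ S, 1 ≤ n) (hT : ∀ m ∈ T, 1 ≤ m) :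
    ∑ n ∈ S, an d θ n * ∑ m ∈ T, zt κ (d * n) m
      = ∑ m ∈ T, (((m:ℝ) ^ (-κ) : ℝ) : ℂ) * ∑ n ∈ S, fm d θ m n := by
  simp_rw [Finset.mul_sum]
  rw [Finset.sum_comm]
  apply Finset.sum_congr rfl; intro m hm
  apply Finset.sum_congr rfl; intro n hn
  exact an_zt hd κ (hT m hm) (hS n hn)

lemma Tint_bound {d θ : ℝ} (hd : 0 < d) {m : ℕ} (hm : 1 ≤ m) {a b : ℝ} (ha : 1 ≤ a) (hab : a ≤ b) (h : ℤ) :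
    ‖Tint (1/2) (Fm d θ m) a b h‖ ≤ (2 + 20/d) * Real.sqrt (b/a) := by
  unfold Tint
  apply osc_second hd ha hab (B := Real.log m - Real.log d + θ/d - h/d)
  intro u hu
  have := (Fm_deriv (θ := θ) hd hm hu).sub ((hasDerivAt_id u).const_mul (h:ℝ))
  convert! this using 1
  field_simp
  ring

lemma sum_Ioc_sym (f : ℕ → ℂ) {P Q : ℕ} (hPQ : P ≤ Q) :
    ∑ m ∈ Finset.Ioc P Q, f m = (∑ m ∈ Finset.Ico P Q, f m + ∑ m ∈ Finset.Ioc P Q, f m)/2 + (f Q - f P)/2 := by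
  have h1 : Finset.Icc P Q = insert P (Finset.Ioc P Q) := by
    ext x; simp only [Finset.mem_Icc, Finset.mem_insert, Finset.mem_Ioc]; omega
  have h2 : Finset.Icc P Q = insert Q (Finset.Ico P Q) := by
    ext x; simp only [Finset.mem_Icc, Finset.mem_insert, Finset.mem_Ico]; omega
  have h3 : ∑ m ∈ Finset.Icc P Q, f m = f P + ∑ m ∈ Finset.Ioc P Q, f m := by
    rw [h1, Finset.sum_insert (by simp)]
  have h4 : ∑ m ∈ Finset.Icc P Q, f m = f Q + ∑ m ∈ Finset.Ico P Q, f m := by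
    rw [h2, Finset.sum_insert (by simp)]
  linear_combination (1/2:ℂ) * (h4 - h3)

lemma fm_poisson {d θ : ℝ} (hd : 0 < d) {m : ℕ} (hm : 1 ≤ m) {Y N : ℕ} (hY : 1 ≤ Y) (hYN : Y ≤ N) {Λ L : ℝ}
    (hΛ : ∀ u ∈ Icc (Y:ℝ) N, |Real.log m - Real.log u| ≤ Λ) (hL : L = d * (Λ + |Real.log d|) + |θ|)
    (K : ℕ) (hK : 2 * L ≤ K + 1) :
    ‖(∑ n ∈ Finset.Ico Y N, fm d θ m n + ∑ n ∈ Finset.Ioc Y N, fm d θ m n)/2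
      - ∑ h ∈ Finset.Icc (-(K:ℤ)) K, Tint (1/2) (Fm d θ m) Y N h‖ ≤ 444 * (d + 2)^2 * ((1 + L)/(K+1)) := by
  have hY' : (1:ℝ) ≤ Y := by exact_mod_cast hY
  have hYN' : (Y:ℝ) ≤ N := by exact_mod_cast hYN
  have hΛ0 : 0 ≤ Λ := (abs_nonneg _).trans (hΛ Y ⟨le_rfl, hYN'⟩)
  have hL0 : 0 ≤ L := by rw [hL]; positivity
  have P := fphase (θ := θ) hd hm hY' hΛ
  rw [← hL] at P
  have key := poisson P (κ := 1/2) (by norm_num) hd.le hY hYN K hK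
  refine key.trans ?_
  have h1 := half_le_one Y hY
  have h2 : (0:ℝ) ≤ (Y:ℝ) ^ (-(1/2:ℝ)) := by positivity
  have h3 : (d + 1/2 * (1/2 + 1) + 1)^2 ≤ (d+2)^2 := pow_le_pow_left₀ (by positivity) (by linarith) 2
  have : (Y:ℝ) ^ (-(1/2:ℝ)) * (d + 1/2 * (1/2 + 1) + 1)^2 ≤ 1 * (d+2)^2 := by gcongr
  rw [one_mul] at this
  gcongr

lemma fm_sum {d θ : ℝ} (hd : 0 < d) {m : ℕ} (hm : 1 ≤ m) {Y N : ℕ} (hY : 1 ≤ Y) (hYN : Y ≤ N) {Λ L : ℝ}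
    (hΛ : ∀ u ∈ Icc (Y:ℝ) N, |Real.log m - Real.log u| ≤ Λ) (hL : L = d * (Λ + |Real.log d|) + |θ|) :
    ‖∑ n ∈ Finset.Ioc Y N, fm d θ m n‖ ≤ (444 * (d + 2)^2 + 4 * (2 + 20/d) + 1) * (1 + L) * Real.sqrt (N/Y) := by
  have hY' : (1:ℝ) ≤ Y := by exact_mod_cast hY
  have hYN' : (Y:ℝ) ≤ N := by exact_mod_cast hYN
  have hΛ0 : 0 ≤ Λ := (abs_nonneg _).trans (hΛ Y ⟨le_rfl, hYN'⟩)
  have hL0 : 0 ≤ L := by rw [hL]; positivity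
  set K := ⌈2 * L⌉₊ with hK
  have hK1 : 2 * L ≤ K := Nat.le_ceil _
  have hK2 : (K:ℝ) ≤ 2 * L + 1 := (Nat.ceil_lt_add_one (by positivity)).le
  have key := fm_poisson (θ := θ) hd hm hY hYN hΛ hL K (by linarith)
  have hs : 1 ≤ Real.sqrt (N/Y) := by
    rw [Real.one_le_sqrt, one_le_div (by linarith)]; exact hYN'
  have hr : (1 + L)/((K:ℝ)+1) ≤ 1 := by rw [div_le_one (by positivity)]; linarith
  have hT : ‖∑ h ∈ Finset.Icc (-(K:ℤ)) K, Tint (1/2) (Fm d θ m) Y N h‖ ≤ (2*K+1) * ((2 + 20/d) * Real.sqrt (N/Y)) := by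
    refine (norm_sum_le _ _).trans ((Finset.sum_le_sum (fun h _ => Tint_bound hd hm hY' hYN' h)).trans (le_of_eq ?_))
    rw [Finset.sum_const, Int.card_Icc, nsmul_eq_mul]
    congr 1
    have : ((K:ℤ) + 1 - -(K:ℤ)).toNat = 2 * K + 1 := by omega
    rw [this]; push_cast; ring
  have hend : ‖(fm d θ m N - fm d θ m Y)/2‖ ≤ 1 := by
    rw [norm_div]
    have := norm_sub_le (fm d θ m N) (fm d θ m Y)
    rw [fm_norm, fm_norm] at this
    have h2 : ‖(2:ℂ)‖ = 2 := by simp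
    rw [h2]
    linarith [half_le_one N (by omega), half_le_one Y hY]
  have eq := sum_Ioc_sym (fun n => fm d θ m n) hYN
  set S := (∑ n ∈ Finset.Ico Y N, fm d θ m n + ∑ n ∈ Finset.Ioc Y N, fm d θ m n)/2 with hS
  set TT := ∑ h ∈ Finset.Icc (-(K:ℤ)) K, Tint (1/2) (Fm d θ m) Y N h with hTT
  have eq2 : ∑ n ∈ Finset.Ioc Y N, fm d θ m n = (S - TT) + TT + (fm d θ m N - fm d θ m Y)/2 := by rw [eq]; ring
  rw [eq2]
  refine norm_add₃_le.trans ?_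
  have hD : 0 < 444 * (d + 2)^2 := by positivity
  have hE : 0 < 2 + 20/d := by positivity
  set Dd := 444 * (d+2)^2
  set E := 2 + 20/d
  set s := Real.sqrt (N/Y)
  have k1 : ‖S - TT‖ ≤ Dd := key.trans (by nlinarith)
  have k2 : ‖TT‖ ≤ 4 * E * (1+L) * s := by
    refine hT.trans ?_
    have : (2 * (K:ℝ) + 1) ≤ 4 * (1 + L) := by linarith
    calc _ ≤ 4 * (1+L) * (E * s) := by gcongr
      _ = _ := by ring
  have h1s : 1 ≤ (1+L) * s := by nlinarith
  calc _ ≤ Dd + 4 * E * (1+L) * s + 1 := by linarith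
    _ ≤ Dd * ((1+L) * s) + 4 * E * (1+L) * s + 1 * ((1+L) * s) := by nlinarith
    _ = _ := by ring


lemma sum_rpow_const {p : ℝ} (hp : 1 < p) : ∃ C > 0, ∀ S : Finset ℕ, ∑ n ∈ S, (n:ℝ) ^ (-p) ≤ C := by
  have hs : Summable (fun n : ℕ => (n:ℝ) ^ (-p)) := Real.summable_nat_rpow.2 (by linarith)
  have h0 : 0 ≤ ∑' n : ℕ, (n:ℝ) ^ (-p) := tsum_nonneg (fun n => by positivity)
  refine ⟨∑' n : ℕ, (n:ℝ) ^ (-p) + 1, by linarith, fun S => ?_⟩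
  have := hs.sum_le_tsum S (fun n _ => by positivity)
  linarith

lemma errE0 {σ d : ℝ} (θ : ℝ) (hσ : σ ≤ 0) (hd : 0 < d) : ∃ C > 0, ∀ S : Finset ℕ, (∀ n ∈ S, 1 ≤ n) →
    ‖∑ n ∈ S, riemannZeta ((σ : ℂ) + 2 * (Real.pi : ℂ) * Complex.I * (d : ℂ) * (n : ℂ)) *
                Complex.exp (2 * (Real.pi : ℂ) * Complex.I * (θ : ℂ) * (n : ℂ)) /
                  ((((n : ℝ) ^ (1 - σ) : ℝ)) : ℂ)
      - (Complex.exp (2 * (Real.pi : ℂ) * Complex.I / 8) * (((d ^ ((1 : ℝ) / 2 - σ) : ℝ)) : ℂ)) *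
        ∑ n ∈ S, an d θ n * riemannZeta (wz (1 - σ) (d * n))‖ ≤ C := by
  obtain ⟨Ca, hCa, hA⟩ := lemmaA (κ := 1 - σ) (by linarith) hd
  obtain ⟨Cc, hCc, hC⟩ := chi_all (κ := 1 - σ) (by linarith) hd
  obtain ⟨Cs, hCs, hSs⟩ := sum_rpow_const (p := 5/4) (by norm_num)
  refine ⟨Cc * Ca * Cs, by positivity, ?_⟩
  intro S hS
  rw [Finset.mul_sum, ← Finset.sum_sub_distrib]
  refine (norm_sum_le _ _).trans ?_
  have hterm : ∀ n ∈ S, ‖riemannZeta ((σ : ℂ) + 2 * (Real.pi : ℂ) * Complex.I * (d : ℂ) * (n : ℂ)) *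
                Complex.exp (2 * (Real.pi : ℂ) * Complex.I * (θ : ℂ) * (n : ℂ)) /
                  ((((n : ℝ) ^ (1 - σ) : ℝ)) : ℂ)
      - (Complex.exp (2 * (Real.pi : ℂ) * Complex.I / 8) * (((d ^ ((1 : ℝ) / 2 - σ) : ℝ)) : ℂ)) *
        (an d θ n * riemannZeta (wz (1 - σ) (d * n)))‖ ≤ Cc * Ca * (n:ℝ) ^ (-(5/4:ℝ)) := by
    intro n hn
    have hn1 := hS n hn
    have hn' : (0:ℝ) < n := by exact_mod_cast hn1
    rw [zeta_fe hσ hd n hn1]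
    have hee : Complex.exp (2 * (Real.pi : ℂ) * Complex.I * (θ : ℂ) * (n : ℂ)) = ee (θ * n) := by
      unfold ee; congr 1; push_cast; ring
    have hmain : (Complex.exp (2 * (Real.pi : ℂ) * Complex.I / 8) * (((d ^ ((1 : ℝ) / 2 - σ) : ℝ)) : ℂ)) * an d θ n
        = Mn (1 - σ) (d * n) * ee (θ * n) / ((((n : ℝ) ^ (1 - σ) : ℝ)) : ℂ) := by
      unfold Mn an
      rw [ee_add]
      have e1 : (d * (n:ℝ)) ^ (1 - σ - 1/2) / (n:ℝ)^(1 - σ) = d ^ ((1:ℝ)/2 - σ) * (n:ℝ)^(-(1/2:ℝ)) := by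
        rw [Real.mul_rpow hd.le hn'.le, mul_div_assoc, ← Real.rpow_sub hn']
        congr 2 <;> ring
      have e1c : (((d * (n:ℝ)) ^ (1 - σ - 1/2) : ℝ) : ℂ) / (((n:ℝ)^(1 - σ) : ℝ) : ℂ)
          = ((d ^ ((1:ℝ)/2 - σ) : ℝ) : ℂ) * (((n:ℝ)^(-(1/2:ℝ)) : ℝ) : ℂ) := by
        rw [← Complex.ofReal_div, e1, Complex.ofReal_mul]
      linear_combination (-Complex.exp (2 * (Real.pi : ℂ) * Complex.I / 8) * ee (θ * n) * ee (d * n * (1 - Real.log (d * n)))) * e1c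
    rw [← mul_assoc, hmain, hee]
    have e2 : chi (wz (1 - σ) (d * n)) * riemannZeta (wz (1 - σ) (d * n)) * ee (θ * n) / ((((n : ℝ) ^ (1 - σ) : ℝ)) : ℂ)
        - Mn (1 - σ) (d * n) * ee (θ * n) / ((((n : ℝ) ^ (1 - σ) : ℝ)) : ℂ) * riemannZeta (wz (1 - σ) (d * n))
        = (chi (wz (1 - σ) (d * n)) - Mn (1 - σ) (d * n)) * riemannZeta (wz (1 - σ) (d * n)) * ee (θ * n) / ((((n : ℝ) ^ (1 - σ) : ℝ)) : ℂ) := by ring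
    rw [e2, norm_div, norm_mul, norm_mul, ee_norm, mul_one, Complex.norm_real, Real.norm_of_nonneg (by positivity),
      div_le_iff₀ (by positivity)]
    calc _ ≤ (Cc * (n:ℝ) ^ (1 - σ - 3/2)) * (Ca * (n:ℝ)^(1/4:ℝ)) := by
          gcongr
          · exact hC n hn1
          · exact (hA n hn1).2
      _ = Cc * Ca * ((n:ℝ) ^ (1 - σ - 3/2) * (n:ℝ)^(1/4:ℝ)) := by ring
      _ = Cc * Ca * ((n:ℝ) ^ (-(5/4:ℝ)) * (n:ℝ)^(1 - σ)) := by
          rw [← Real.rpow_add hn', ← Real.rpow_add hn']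
          congr 2; ring
      _ = _ := by ring
  refine (Finset.sum_le_sum hterm).trans ?_
  rw [← Finset.mul_sum]
  gcongr
  exact hSs S

/-- replacing zeta by a long partial sum -/
lemma errZ {κ d : ℝ} (θ : ℝ) (hκ : 1 ≤ κ) (hd : 0 < d) : ∃ C > 0, ∀ (S : Finset ℕ) (P : ℕ), (∀ n ∈ S, 1 ≤ n ∧ n ≤ P ∧ 2 * (d * n) ≤ P) →
    ‖∑ n ∈ S, an d θ n * (riemannZeta (wz κ (d * n)) - ∑ m ∈ Finset.Ioc 0 P, zt κ (d * n) m)‖ ≤ C := by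
  obtain ⟨Cs, hCs, hSs⟩ := sum_rpow_const (p := 3/2) (by norm_num)
  set C0 := (666 * ((κ+1) * (κ + 2) + 2)^2 + 1) with hC0
  have hC00 : 0 < C0 := by positivity
  refine ⟨(C0 + 1/d) * Cs, by positivity, ?_⟩
  intro S P hS
  refine (norm_sum_le _ _).trans ?_
  have hterm : ∀ n ∈ S, ‖an d θ n * (riemannZeta (wz κ (d * n)) - ∑ m ∈ Finset.Ioc 0 P, zt κ (d * n) m)‖
      ≤ (C0 + 1/d) * (n:ℝ)^(-(3/2:ℝ)) := by
    intro n hn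
    obtain ⟨h1, h2, h3⟩ := hS n hn
    have hn' : (0:ℝ) < n := by exact_mod_cast h1
    have hnP : (n:ℝ) ≤ P := by exact_mod_cast h2
    have z := zeta_trunc hκ (by positivity : 0 < d * n) P (by omega) h3
    rw [norm_mul, an_norm]
    have z2 : C0 * (1/(P:ℝ)) + 1/(d * n) ≤ (C0 + 1/d) * (1/n) := by
      have : 1/(P:ℝ) ≤ 1/n := one_div_le_one_div_of_le hn' hnP
      calc _ ≤ C0 * (1/(n:ℝ)) + 1/(d*n) := by gcongr
        _ = _ := by field_simp
    calc _ ≤ (n:ℝ)^(-(1/2:ℝ)) * ((C0 + 1/d) * (1/n)) := by gcongr; exact z.trans z2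
      _ = (C0 + 1/d) * ((n:ℝ)^(-(1/2:ℝ)) * (n:ℝ)^(-1:ℝ)) := by rw [Real.rpow_neg_one]; ring
      _ = _ := by rw [← Real.rpow_add hn']; norm_num
  refine (Finset.sum_le_sum hterm).trans ?_
  rw [← Finset.mul_sum]
  gcongr
  exact hSs S

lemma log_diff {m u R : ℝ} (hm : 1 ≤ m) (hmR : m ≤ R) (hu : 1 ≤ u) (huR : u ≤ R) :
    |Real.log m - Real.log u| ≤ Real.log R := by
  have h1 := Real.log_nonneg hm
  have h2 := Real.log_nonneg hu
  have h3 := Real.log_le_log (by linarith) hmR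
  have h4 := Real.log_le_log (by linarith) huR
  rw [abs_le]; constructor <;> linarith

set_option maxHeartbeats 2000000 in
lemma errE1 {κ d : ℝ} (θ : ℝ) (hκ : 1 ≤ κ) (hd : 0 < d) : ∃ C > 0, ∀ X : ℕ, 1 ≤ X →
    ‖∑ n ∈ Finset.Ioc 0 X, an d θ n * riemannZeta (wz κ (d * n))‖ ≤ C * Real.sqrt X := by
  obtain ⟨Cz, hCz, hZ⟩ := errZ θ hκ hd
  obtain ⟨K0, hK0⟩ := exists_nat_ge (2 * d + 1)
  set Cf := (444 * (d + 2)^2 + 4 * (2 + 20/d) + 1) with hCf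
  have hCf0 : 0 < Cf := by positivity
  have hK1 : (1:ℝ) ≤ K0 := by linarith
  have hlK : 0 ≤ Real.log K0 := Real.log_nonneg hK1
  set A := 13 + Real.log K0 with hA
  have hA0 : 0 < A := by linarith
  set A2 := 1 + d * (A + |Real.log d|) + |θ| with hA2
  have hA20 : 0 < A2 := by positivity
  refine ⟨Cz + A * (2 + Cf * A2), by positivity, ?_⟩
  intro X hX
  have hX' : (1:ℝ) ≤ X := by exact_mod_cast hX
  have hX0 : (0:ℝ) < X := by linarith
  have hsq : 1 ≤ Real.sqrt X := by rw [Real.one_le_sqrt]; exact hX'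
  set P := K0 * X with hP
  have hPr : (P:ℝ) = K0 * X := by rw [hP]; push_cast; rfl
  have hK0n : 1 ≤ K0 := by exact_mod_cast hK1
  have hXP : X ≤ P := by rw [hP]; nlinarith
  have hP1 : 1 ≤ P := by omega
  have z := hZ (Finset.Ioc 0 X) P (by
    intro n hn
    rw [Finset.mem_Ioc] at hn
    have h2 : (n:ℝ) ≤ X := by exact_mod_cast hn.2
    have h0 : (0:ℝ) ≤ n := by positivity
    refine ⟨hn.1, by omega, ?_⟩
    rw [hPr]
    nlinarith)
  set x12 := (X:ℝ)^(1/12:ℝ) with hx12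
  have hx1 : 1 ≤ x12 := Real.one_le_rpow hX' (by norm_num)
  have hlogP : 1 + Real.log P ≤ A * x12 := by
    rw [hPr, Real.log_mul (by linarith) (by linarith)]
    have := Real.log_le_rpow_div hX0.le (ε := 1/12) (by norm_num)
    rw [← hx12] at this
    rw [hA]
    nlinarith
  have hlogP0 : 0 ≤ Real.log P := Real.log_nonneg (by exact_mod_cast hP1)
  set Y := ⌈(X:ℝ)^(1/3:ℝ)⌉₊ with hY
  set x3 := (X:ℝ)^(1/3:ℝ) with hx3
  have hx31 : 1 ≤ x3 := Real.one_le_rpow hX' (by norm_num)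
  have hY1 : 1 ≤ Y := Nat.one_le_iff_ne_zero.2 (Nat.ceil_pos.2 (by linarith)).ne'
  have hYle : x3 ≤ Y := Nat.le_ceil _
  have hYlt : (Y:ℝ) ≤ 2 * x3 := by
    have := (Nat.ceil_lt_add_one (by linarith : 0 ≤ x3)).le
    linarith
  have hYX : Y ≤ X := by
    rw [hY]; apply Nat.ceil_le.2
    calc x3 ≤ (X:ℝ)^(1:ℝ) := Real.rpow_le_rpow_of_exponent_le hX' (by norm_num)
      _ = X := Real.rpow_one _
  have hsqXY : Real.sqrt (X/Y) ≤ x3 := by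
    rw [Real.sqrt_le_left (by linarith), div_le_iff₀ (by linarith)]
    have : x3^3 = X := by
      rw [hx3, ← Real.rpow_natCast, ← Real.rpow_mul hX0.le]; norm_num
    nlinarith [pow_pos (by linarith : 0 < x3) 2]
  have hinner : ∀ m ∈ Finset.Ioc 0 P, ‖∑ n ∈ Finset.Ioc 0 X, fm d θ m n‖ ≤ (2 + Cf * A2) * (x12 * x3) := by
    intro m hm
    rw [Finset.mem_Ioc] at hm
    have hm1 : (1:ℝ) ≤ m := by exact_mod_cast hm.1
    have hmP : (m:ℝ) ≤ P := by exact_mod_cast hm.2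
    have hXPr : (X:ℝ) ≤ P := by exact_mod_cast hXP
    have hY1r : (1:ℝ) ≤ Y := by exact_mod_cast hY1
    have f := fm_sum (θ := θ) hd (m := m) hm.1 hY1 hYX (Λ := Real.log P)
      (fun u hu => log_diff hm1 hmP (by linarith [hu.1]) (by linarith [hu.2])) rfl
    rw [← Finset.sum_Ioc_consecutive (fun n => fm d θ m n) (Nat.zero_le Y) hYX]
    refine (norm_add_le _ _).trans ?_
    have t : ‖∑ n ∈ Finset.Ioc 0 Y, fm d θ m n‖ ≤ 2 * x3 := by
      refine (norm_sum_le _ _).trans ?_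
      calc _ ≤ ∑ n ∈ Finset.Ioc 0 Y, (1:ℝ) := Finset.sum_le_sum (fun n hn => by
            rw [fm_norm]; exact half_le_one n (Finset.mem_Ioc.1 hn).1)
        _ = Y := by simp
        _ ≤ _ := hYlt
    have hLL : 1 + (d * (Real.log P + |Real.log d|) + |θ|) ≤ A2 * x12 := by
      have : Real.log P ≤ A * x12 := by linarith
      have q1 : |Real.log d| ≤ |Real.log d| * x12 := le_mul_of_one_le_right (abs_nonneg _) hx1
      have q2 : |θ| ≤ |θ| * x12 := le_mul_of_one_le_right (abs_nonneg _) hx1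
      calc _ ≤ x12 + (d * (A * x12 + |Real.log d| * x12) + |θ| * x12) := by gcongr
        _ = _ := by rw [hA2]; ring
    have f2 : ‖∑ n ∈ Finset.Ioc Y X, fm d θ m n‖ ≤ Cf * (A2 * x12) * x3 := by
      refine f.trans ?_
      gcongr
    have : 2 * x3 ≤ 2 * (x12 * x3) := by nlinarith
    calc _ ≤ 2 * (x12 * x3) + Cf * (A2 * x12) * x3 := by linarith
      _ = _ := by ring
  have hsw : ‖∑ n ∈ Finset.Ioc 0 X, an d θ n * ∑ m ∈ Finset.Ioc 0 P, zt κ (d * n) m‖ ≤ A * (2 + Cf * A2) * Real.sqrt X := by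
    rw [swap_sum hd κ _ _ (fun n hn => (Finset.mem_Ioc.1 hn).1) (fun n hn => (Finset.mem_Ioc.1 hn).1)]
    refine (norm_sum_le _ _).trans ?_
    calc _ ≤ ∑ m ∈ Finset.Ioc 0 P, (m:ℝ)^(-κ) * ((2 + Cf * A2) * (x12 * x3)) := by
          apply Finset.sum_le_sum
          intro m hm
          rw [norm_mul, Complex.norm_real, Real.norm_of_nonneg (by positivity)]
          gcongr
          exact hinner m hm
      _ = (∑ m ∈ Finset.Ioc 0 P, (m:ℝ)^(-κ)) * ((2 + Cf * A2) * (x12 * x3)) := by rw [Finset.sum_mul]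
      _ ≤ (A * x12) * ((2 + Cf * A2) * (x12 * x3)) := by
          gcongr
          exact (sum_rpow_le hκ P hP1).trans hlogP
      _ = A * (2 + Cf * A2) * (x12 * x12 * x3) := by ring
      _ = _ := by
          rw [hx12, hx3, ← Real.rpow_add hX0, ← Real.rpow_add hX0, Real.sqrt_eq_rpow]
          norm_num
  have eq : ∑ n ∈ Finset.Ioc 0 X, an d θ n * riemannZeta (wz κ (d * n))
      = ∑ n ∈ Finset.Ioc 0 X, an d θ n * (riemannZeta (wz κ (d * n)) - ∑ m ∈ Finset.Ioc 0 P, zt κ (d * n) m)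
        + ∑ n ∈ Finset.Ioc 0 X, an d θ n * ∑ m ∈ Finset.Ioc 0 P, zt κ (d * n) m := by
    rw [← Finset.sum_add_distrib]
    apply Finset.sum_congr rfl; intro n _; ring
  rw [eq]
  refine (norm_add_le _ _).trans ?_
  calc _ ≤ Cz * Real.sqrt X + A * (2 + Cf * A2) * Real.sqrt X := by
        apply add_le_add _ hsw
        nlinarith
    _ = _ := by ring

lemma errE2 {κ d : ℝ} (θ : ℝ) (hκ : 1 ≤ κ) (hd : 0 < d) : ∃ C > 0, ∀ X N M : ℕ, 1 ≤ X → X ≤ N → N ≤ M →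
    ‖∑ n ∈ Finset.Ioc X N, an d θ n * (riemannZeta (wz κ (d * n)) - ∑ m ∈ Finset.Ioc 0 M, zt κ (d * n) m)‖ ≤ C := by
  obtain ⟨Cz, hCz, hZ⟩ := errZ θ hκ hd
  obtain ⟨K0, hK0⟩ := exists_nat_ge (2 * d + 1)
  set Cf := (444 * (d + 2)^2 + 4 * (2 + 20/d) + 1) with hCf
  have hCf0 : 0 < Cf := by positivity
  have hK1 : (1:ℝ) ≤ K0 := by linarith
  have hK0n : 1 ≤ K0 := by exact_mod_cast hK1
  set Λ := |Real.log (4 * d * K0)| with hΛ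
  set L := d * (Λ + |Real.log d|) + |θ| with hL
  have hL0 : 0 ≤ L := by positivity
  refine ⟨Cz + (Cz + K0 * (Cf * (1 + L) * Real.sqrt (4 * d))), by positivity, ?_⟩
  intro X N M hX hXN hNM
  have hM1 : 1 ≤ M := by omega
  have hM1r : (1:ℝ) ≤ M := by exact_mod_cast hM1
  have hNMr : (N:ℝ) ≤ M := by exact_mod_cast hNM
  set Y0 := ⌊(M:ℝ)/(2*d)⌋₊ with hY0
  set Y := min N (max X Y0) with hY
  have hXY : X ≤ Y := le_min hXN (le_max_left _ _)
  have hYN : Y ≤ N := min_le_left _ _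
  rw [← Finset.sum_Ioc_consecutive _ hXY hYN]
  refine (norm_add_le _ _).trans (add_le_add ?_ ?_)
  · apply hZ
    intro n hn
    rw [Finset.mem_Ioc] at hn
    have hnY0 : n ≤ Y0 := by
      have h1 : n ≤ max X Y0 := hn.2.trans (min_le_right _ _)
      rcases le_max_iff.1 h1 with h | h <;> omega
    refine ⟨by omega, by omega, ?_⟩
    have h1 : (n:ℝ) ≤ M/(2*d) := (Nat.cast_le.2 hnY0).trans (Nat.floor_le (by positivity))
    rw [le_div_iff₀ (by positivity)] at h1
    linarith
  · rcases eq_or_lt_of_le hYN with h | hlt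
    · rw [h, Finset.Ioc_self, Finset.sum_empty, norm_zero]; positivity
    have hYmax : Y = max X Y0 := by
      rcases min_choice N (max X Y0) with h | h
      · rw [← hY] at h; omega
      · exact h
    have hY1 : 1 ≤ Y := by omega
    have hY1r : (1:ℝ) ≤ Y := by exact_mod_cast hY1
    have hYM : (M:ℝ) ≤ 4 * d * Y := by
      have h1 : Y0 ≤ Y := by rw [hYmax]; exact le_max_right _ _
      have h2 : (Y0:ℝ) ≤ Y := by exact_mod_cast h1
      have h3 : (M:ℝ)/(2*d) < Y0 + 1 := Nat.lt_floor_add_one _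
      have h4 : (M:ℝ)/(2*d) ≤ 2 * Y := by linarith
      rw [div_le_iff₀ (by positivity)] at h4
      linarith
    set P := K0 * M with hP
    have hPr : (P:ℝ) = K0 * M := by rw [hP]; push_cast; rfl
    have hMP : M ≤ P := by rw [hP]; nlinarith
    have z := hZ (Finset.Ioc Y N) P (by
      intro n hn
      rw [Finset.mem_Ioc] at hn
      have h2 : (n:ℝ) ≤ M := (by exact_mod_cast hn.2 : (n:ℝ) ≤ N).trans hNMr
      have h0 : (0:ℝ) ≤ n := by positivity
      refine ⟨by omega, by omega, ?_⟩
      rw [hPr]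
      nlinarith)
    have eq : ∑ n ∈ Finset.Ioc Y N, an d θ n * (riemannZeta (wz κ (d * n)) - ∑ m ∈ Finset.Ioc 0 M, zt κ (d * n) m)
      = ∑ n ∈ Finset.Ioc Y N, an d θ n * (riemannZeta (wz κ (d * n)) - ∑ m ∈ Finset.Ioc 0 P, zt κ (d * n) m)
        + ∑ n ∈ Finset.Ioc Y N, an d θ n * ∑ m ∈ Finset.Ioc M P, zt κ (d * n) m := by
      rw [← Finset.sum_add_distrib]
      apply Finset.sum_congr rfl; intro n _
      rw [← Finset.sum_Ioc_consecutive (fun m => zt κ (d * n) m) (Nat.zero_le M) hMP]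
      ring
    rw [eq]
    refine (norm_add_le _ _).trans (add_le_add z ?_)
    rw [swap_sum hd κ _ _ (fun n hn => by have := (Finset.mem_Ioc.1 hn).1; omega) (fun n hn => by have := (Finset.mem_Ioc.1 hn).1; omega)]
    refine (norm_sum_le _ _).trans ?_
    have hterm : ∀ m ∈ Finset.Ioc M P, ‖(((m:ℝ) ^ (-κ) : ℝ) : ℂ) * ∑ n ∈ Finset.Ioc Y N, fm d θ m n‖
        ≤ (1/M) * (Cf * (1 + L) * Real.sqrt (4 * d)) := by
      intro m hm
      rw [Finset.mem_Ioc] at hm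
      have hm1 : 1 ≤ m := by omega
      have hmM : (M:ℝ) ≤ m := by exact_mod_cast hm.1.le
      have hmP : (m:ℝ) ≤ K0 * M := by rw [← hPr]; exact_mod_cast hm.2
      rw [norm_mul, Complex.norm_real, Real.norm_of_nonneg (by positivity)]
      have c1 : (m:ℝ)^(-κ) ≤ 1/M := (rpow_neg_le_inv hκ m hm1).trans (one_div_le_one_div_of_le (by linarith) hmM)
      have f := fm_sum (θ := θ) hd (m := m) hm1 hY1 hYN (Λ := Λ) (L := L) (by
        intro u hu
        have hu1 : 1 ≤ u := by linarith [hu.1]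
        have huM : u ≤ m := by linarith [hu.2]
        have l1 : Real.log u ≤ Real.log m := Real.log_le_log (by linarith) huM
        have hpos : 0 < 4 * d * (K0:ℝ) := by positivity
        have hm2 : (m:ℝ) ≤ 4 * d * K0 * u := by
          have : (M:ℝ) ≤ 4 * d * u := hYM.trans (by gcongr; exact hu.1)
          calc (m:ℝ) ≤ K0 * M := hmP
            _ ≤ K0 * (4 * d * u) := by gcongr
            _ = _ := by ring
        have l2 : Real.log m ≤ Real.log (4 * d * K0) + Real.log u := by
          rw [← Real.log_mul hpos.ne' (by linarith)]
          exact Real.log_le_log (by exact_mod_cast hm1) hm2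
        rw [abs_of_nonneg (by linarith)]
        exact le_trans (by linarith) (le_abs_self _)) hL
      have hs : Real.sqrt (N/Y) ≤ Real.sqrt (4 * d) := by
        apply Real.sqrt_le_sqrt
        rw [div_le_iff₀ (by linarith)]
        linarith
      have f2 := f.trans (by gcongr : Cf * (1 + L) * Real.sqrt (N/Y) ≤ Cf * (1 + L) * Real.sqrt (4 * d))
      gcongr
    refine (Finset.sum_le_sum hterm).trans ?_
    rw [Finset.sum_const, Nat.card_Ioc, nsmul_eq_mul]
    have hc : ((P - M : ℕ) : ℝ) ≤ K0 * M := by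
      rw [← hPr]; exact_mod_cast Nat.sub_le P M
    calc _ ≤ (K0 * M) * ((1/(M:ℝ)) * (Cf * (1 + L) * Real.sqrt (4 * d))) := by gcongr
      _ = _ := by field_simp


lemma wsum {σ α C2 : ℝ} (hσ : σ ≤ 0) (hα0 : 0 < α) (hα1 : α ≤ 1) (hC2 : 1 < C2) :
    ∃ C > 0, ∀ N M : ℕ, 2 ≤ N → N ≤ M → (M:ℝ) ≤ C2 * N →
      (∑ m ∈ Finset.Ioc 0 M, (m:ℝ)^(-(1 - σ))) * (Real.log ((M:ℝ) * N))^(-α)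
        ≤ C * (1 + (if σ = 0 then 1 else 0) * (Real.log N)^(1 - α)) := by
  by_cases h0 : σ = 0
  · have hl2 : 0 < Real.log 2 := Real.log_pos (by norm_num)
    have hlC : 0 < Real.log C2 := Real.log_pos hC2
    set B := 2 + Real.log C2 / Real.log 2 with hB
    have hB1 : 1 ≤ B := by have : 0 < Real.log C2 / Real.log 2 := by positivity
                           linarith
    refine ⟨2 * B, by positivity, ?_⟩
    intro N M hN hNM hMC
    have hN' : (2:ℝ) ≤ N := by exact_mod_cast hN
    have hM' : (N:ℝ) ≤ M := by exact_mod_cast hNM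
    have hlN : Real.log 2 ≤ Real.log N := Real.log_le_log (by norm_num) hN'
    have hell : Real.log ((M:ℝ) * N) = Real.log M + Real.log N := Real.log_mul (by linarith) (by linarith)
    have hlM : Real.log N ≤ Real.log M := Real.log_le_log (by linarith) hM'
    have hlM2 : Real.log M ≤ Real.log C2 + Real.log N := by
      rw [← Real.log_mul (by linarith) (by linarith)]
      exact Real.log_le_log (by linarith) hMC
    set ℓ := Real.log ((M:ℝ) * N) with hℓ
    have hl2' := Real.log_two_gt_d9
    have hl1 : 1 ≤ ℓ := by linarith
    have hsum := sum_rpow_le (κ := 1 - σ) (by linarith) M (by omega)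
    have hℓB : ℓ ≤ B * Real.log N := by
      have : Real.log C2 ≤ Real.log C2 / Real.log 2 * Real.log N := by
        rw [div_mul_eq_mul_div, le_div_iff₀ hl2]
        gcongr
      rw [hB]; linarith
    have hpow : ℓ^(1-α) ≤ B * (Real.log N)^(1-α) := by
      calc ℓ^(1-α) ≤ (B * Real.log N)^(1-α) := Real.rpow_le_rpow (by linarith) hℓB (by linarith)
        _ = B^(1-α) * (Real.log N)^(1-α) := Real.mul_rpow (by linarith) (by linarith)
        _ ≤ B * (Real.log N)^(1-α) := by
          have : B^(1-α) ≤ B^(1:ℝ) := Real.rpow_le_rpow_of_exponent_le hB1 (by linarith)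
          rw [Real.rpow_one] at this
          have h2 : 0 ≤ (Real.log N)^(1-α) := Real.rpow_nonneg (by linarith) _
          gcongr
    have hneg : 0 ≤ ℓ^(-α) := Real.rpow_nonneg (by linarith) _
    rw [if_pos h0, one_mul]
    calc _ ≤ (2 * ℓ) * ℓ^(-α) := by
          gcongr
          linarith
      _ = 2 * ℓ^(1-α) := by
          rw [sub_eq_add_neg, Real.rpow_add (by linarith), Real.rpow_one]; ring
      _ ≤ 2 * (B * (Real.log N)^(1-α)) := by gcongr
      _ ≤ _ := by nlinarith
  · have hlt : σ < 0 := lt_of_le_of_ne hσ h0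
    obtain ⟨C, hC, hS⟩ := sum_rpow_const (p := 1 - σ) (by linarith)
    refine ⟨C, hC, ?_⟩
    intro N M hN hNM hMC
    rw [if_neg h0, zero_mul, add_zero, mul_one]
    have hN' : (2:ℝ) ≤ N := by exact_mod_cast hN
    have hM' : (N:ℝ) ≤ M := by exact_mod_cast hNM
    have hl1 : 1 ≤ Real.log ((M:ℝ) * N) := by
      rw [Real.le_log_iff_exp_le (mul_pos (by linarith) (by linarith))]
      have := Real.exp_one_lt_d9
      nlinarith
    have h1 : (Real.log ((M:ℝ) * N))^(-α) ≤ 1 := Real.rpow_le_one_of_one_le_of_nonpos hl1 (by linarith)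
    have h2 : 0 ≤ (Real.log ((M:ℝ) * N))^(-α) := Real.rpow_nonneg (by linarith) _
    calc _ ≤ C * 1 := by gcongr; exact hS _
      _ = C := mul_one C

set_option maxHeartbeats 2000000 in
lemma errE3 {σ d α C2 : ℝ} (θ : ℝ) (hσ : σ ≤ 0) (hd : 0 < d) (hα0 : 0 < α) (hα1 : α ≤ 1) (hC2 : 1 < C2)
    {c : ℝ} (hc1 : 1 ≤ c) (hc : 2 * (d * (1 + |Real.log d|) + |θ|) ≤ c) :
    ∃ C > 0, ∀ X N M K : ℕ, 1 ≤ X → 2 ≤ N → X ≤ N → N ≤ M → (M:ℝ) ≤ C2 * N →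
      c * (Real.log ((M:ℝ) * N))^(1 + α) ≤ K + 1 →
      ‖∑ n ∈ Finset.Ioc X N, an d θ n * ∑ m ∈ Finset.Ioc 0 M, zt (1 - σ) (d * n) m
        - ∑ m ∈ Finset.Ioc 0 M, (((m:ℝ) ^ (-(1 - σ)) : ℝ) : ℂ) * ∑ h ∈ Finset.Icc (-(K:ℤ)) K, Tint (1/2) (Fm d θ m) X N h‖
        ≤ C * (1 + (if σ = 0 then 1 else 0) * (Real.log N)^(1 - α)) := by
  obtain ⟨Ca, hCa, hA⟩ := lemmaA (κ := 1 - σ) (by linarith) hd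
  obtain ⟨Cw, hCw, hW⟩ := wsum hσ hα0 hα1 hC2
  set L1 := d * (1 + |Real.log d|) + |θ| with hL1
  have hL10 : 0 < L1 := by positivity
  set E := 444 * (d + 2)^2 * (1 + L1) with hE
  have hE0 : 0 < E := by positivity
  refine ⟨E * Cw + Ca, by positivity, ?_⟩
  intro X N M K hX hN hXN hNM hMC hK
  have hN' : (2:ℝ) ≤ N := by exact_mod_cast hN
  have hM' : (N:ℝ) ≤ M := by exact_mod_cast hNM
  have hX' : (1:ℝ) ≤ X := by exact_mod_cast hX
  have hw := hW N M hN hNM hMC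
  set ℓ := Real.log ((M:ℝ) * N) with hℓ
  have hl1 : 1 ≤ ℓ := by
    rw [hℓ, Real.le_log_iff_exp_le (mul_pos (by linarith) (by linarith))]
    have := Real.exp_one_lt_d9
    nlinarith
  have hl0 : 0 < ℓ := by linarith
  have hR : 1 ≤ 1 + (if σ = 0 then (1:ℝ) else 0) * (Real.log N)^(1 - α) := by
    have h2 : 0 ≤ (Real.log N)^(1-α) := Real.rpow_nonneg (Real.log_nonneg (by linarith)) _
    split_ifs <;> linarith
  set R := 1 + (if σ = 0 then (1:ℝ) else 0) * (Real.log N)^(1 - α) with hRdef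
  obtain ⟨L, hL⟩ : ∃ L, L = d * (ℓ + |Real.log d|) + |θ| := ⟨_, rfl⟩
  have hL0 : 0 ≤ L := by rw [hL]; positivity
  have hLle : L ≤ L1 * ℓ := by
    rw [hL, hL1]
    have q1 : |Real.log d| ≤ |Real.log d| * ℓ := le_mul_of_one_le_right (abs_nonneg _) hl1
    have q2 : |θ| ≤ |θ| * ℓ := le_mul_of_one_le_right (abs_nonneg _) hl1
    calc _ ≤ d * (ℓ + |Real.log d| * ℓ) + |θ| * ℓ := by gcongr
      _ = _ := by ring
  have hpow : ℓ^(1+α) = ℓ * ℓ^α := by rw [Real.rpow_add hl0, Real.rpow_one]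
  have hla : 1 ≤ ℓ^α := Real.one_le_rpow hl1 hα0.le
  have h2L : 2 * L ≤ K + 1 := by
    refine le_trans ?_ hK
    rw [hpow]
    calc 2 * L ≤ c * ℓ := by nlinarith
      _ ≤ c * (ℓ * ℓ^α) := by gcongr; exact le_mul_of_one_le_right hl0.le hla
  have hfrac : (1 + L)/((K:ℝ)+1) ≤ (1 + L1) * ℓ^(-α) := by
    rw [div_le_iff₀ (by positivity), Real.rpow_neg hl0.le]
    have h3 : ℓ * ℓ^α ≤ K + 1 := by
      rw [← hpow]; refine le_trans ?_ hK
      exact le_mul_of_one_le_left (by positivity) hc1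
    have h4 : ℓ ≤ (ℓ^α)⁻¹ * (K+1) := by
      rw [inv_mul_eq_div, le_div_iff₀ (by positivity)]; exact h3
    calc 1 + L ≤ (1 + L1) * ℓ := by nlinarith
      _ ≤ (1 + L1) * ((ℓ^α)⁻¹ * (K+1)) := by gcongr
      _ = _ := by ring
  have hMN : (M:ℝ) ≤ M * N := le_mul_of_one_le_right (by linarith) (by linarith)
  have hper : ∀ m ∈ Finset.Ioc 0 M, ‖(∑ n ∈ Finset.Ico X N, fm d θ m n + ∑ n ∈ Finset.Ioc X N, fm d θ m n)/2
      - ∑ h ∈ Finset.Icc (-(K:ℤ)) K, Tint (1/2) (Fm d θ m) X N h‖ ≤ E * ℓ^(-α) := by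
    intro m hm
    rw [Finset.mem_Ioc] at hm
    have hm1 : (1:ℝ) ≤ m := by exact_mod_cast hm.1
    have hmM : (m:ℝ) ≤ M := by exact_mod_cast hm.2
    refine (fm_poisson (θ := θ) hd hm.1 hX hXN (Λ := ℓ) (fun u hu => log_diff hm1 (hmM.trans hMN) (by linarith [hu.1]) ((hu.2.trans hM').trans hMN)) hL K h2L).trans ?_
    calc _ ≤ 444 * (d + 2)^2 * ((1 + L1) * ℓ^(-α)) := by gcongr
      _ = _ := by rw [hE]; ring
  have hend : ∀ n : ℕ, 1 ≤ n → ‖an d θ n * ∑ m ∈ Finset.Ioc 0 M, zt (1 - σ) (d * n) m‖ ≤ Ca := by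
    intro n hn
    have hn' : (1:ℝ) ≤ n := by exact_mod_cast hn
    rw [norm_mul, an_norm]
    calc _ ≤ (n:ℝ)^(-(1/2:ℝ)) * (Ca * (n:ℝ)^(1/4:ℝ)) := by gcongr; exact (hA n hn).1 M
      _ = Ca * ((n:ℝ)^(-(1/2:ℝ)) * (n:ℝ)^(1/4:ℝ)) := by ring
      _ = Ca * (n:ℝ)^(-(1/4:ℝ)) := by rw [← Real.rpow_add (by linarith)]; norm_num
      _ ≤ Ca * 1 := by gcongr; exact Real.rpow_le_one_of_one_le_of_nonpos hn' (by norm_num)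
      _ = Ca := mul_one _
  have hsingle : ∀ n : ℕ, 1 ≤ n → ∑ m ∈ Finset.Ioc 0 M, (((m:ℝ) ^ (-(1 - σ)) : ℝ) : ℂ) * fm d θ m n
      = an d θ n * ∑ m ∈ Finset.Ioc 0 M, zt (1 - σ) (d * n) m := by
    intro n hn
    rw [Finset.mul_sum]
    apply Finset.sum_congr rfl; intro m hm
    exact (an_zt hd _ (Finset.mem_Ioc.1 hm).1 hn).symm
  rw [swap_sum hd (1 - σ) _ _ (fun n hn => by have := (Finset.mem_Ioc.1 hn).1; omega) (fun n hn => (Finset.mem_Ioc.1 hn).1)]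
  have eq : ∑ m ∈ Finset.Ioc 0 M, (((m:ℝ) ^ (-(1 - σ)) : ℝ) : ℂ) * ∑ n ∈ Finset.Ioc X N, fm d θ m n
      - ∑ m ∈ Finset.Ioc 0 M, (((m:ℝ) ^ (-(1 - σ)) : ℝ) : ℂ) * ∑ h ∈ Finset.Icc (-(K:ℤ)) K, Tint (1/2) (Fm d θ m) X N h
      = ∑ m ∈ Finset.Ioc 0 M, (((m:ℝ) ^ (-(1 - σ)) : ℝ) : ℂ) *
        ((∑ n ∈ Finset.Ico X N, fm d θ m n + ∑ n ∈ Finset.Ioc X N, fm d θ m n)/2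
          - ∑ h ∈ Finset.Icc (-(K:ℤ)) K, Tint (1/2) (Fm d θ m) X N h)
        + (an d θ N * ∑ m ∈ Finset.Ioc 0 M, zt (1 - σ) (d * N) m - an d θ X * ∑ m ∈ Finset.Ioc 0 M, zt (1 - σ) (d * X) m)/2 := by
    rw [← hsingle N (by omega), ← hsingle X hX, ← Finset.sum_sub_distrib, ← Finset.sum_sub_distrib, Finset.sum_div, ← Finset.sum_add_distrib]
    apply Finset.sum_congr rfl; intro m _
    have hs := sum_Ioc_sym (fun n => fm d θ m n) hXN
    linear_combination (((m:ℝ) ^ (-(1 - σ)) : ℝ) : ℂ) * hs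
  rw [eq]
  have b1 : ‖∑ m ∈ Finset.Ioc 0 M, (((m:ℝ) ^ (-(1 - σ)) : ℝ) : ℂ) *
        ((∑ n ∈ Finset.Ico X N, fm d θ m n + ∑ n ∈ Finset.Ioc X N, fm d θ m n)/2
          - ∑ h ∈ Finset.Icc (-(K:ℤ)) K, Tint (1/2) (Fm d θ m) X N h)‖ ≤ E * Cw * R := by
    refine (norm_sum_le _ _).trans ?_
    calc _ ≤ ∑ m ∈ Finset.Ioc 0 M, (m:ℝ)^(-(1-σ)) * (E * ℓ^(-α)) := by
          apply Finset.sum_le_sum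
          intro m hm
          rw [norm_mul, Complex.norm_real, Real.norm_of_nonneg (by positivity)]
          gcongr
          exact hper m hm
      _ = E * ((∑ m ∈ Finset.Ioc 0 M, (m:ℝ)^(-(1-σ))) * ℓ^(-α)) := by rw [← Finset.sum_mul]; ring
      _ ≤ E * (Cw * R) := by gcongr
      _ = _ := by ring
  have b2 : ‖(an d θ N * ∑ m ∈ Finset.Ioc 0 M, zt (1 - σ) (d * N) m - an d θ X * ∑ m ∈ Finset.Ioc 0 M, zt (1 - σ) (d * X) m)/2‖ ≤ Ca := by
    rw [norm_div]
    have h2 : ‖(2:ℂ)‖ = 2 := by simp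
    rw [h2]
    have := norm_sub_le (an d θ N * ∑ m ∈ Finset.Ioc 0 M, zt (1 - σ) (d * N) m) (an d θ X * ∑ m ∈ Finset.Ioc 0 M, zt (1 - σ) (d * X) m)
    linarith [hend N (by omega), hend X hX]
  refine (norm_add_le _ _).trans ?_
  nlinarith

lemma integral_conv (d θ : ℝ) (m X N : ℕ) (hX : 1 ≤ X) (hXN : X ≤ N) (h : ℤ) :
    ∫ x in (X : ℝ)..(N : ℝ), Complex.exp (2 * (Real.pi : ℂ) * Complex.I *
      ((Fm d θ m x - (h : ℝ) * x : ℝ) : ℂ)) / ((Real.sqrt x : ℝ) : ℂ) = Tint (1/2) (Fm d θ m) X N h := by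
  unfold Tint
  apply intervalIntegral.integral_congr
  intro x hx
  rw [uIcc_of_le (by exact_mod_cast hXN)] at hx
  have hX' : (1:ℝ) ≤ X := by exact_mod_cast hX
  have hx0 : 0 < x := by linarith [hx.1]
  simp only
  rw [Real.rpow_neg hx0.le, ← Real.sqrt_eq_rpow, Complex.ofReal_inv, div_eq_mul_inv, mul_comm]
  rfl

end Helpers

theorem statement14 (σ d θ : ℝ) (hσ : σ ≤ 0) (hd : 0 < d)
    (α : ℝ) (hα0 : 0 < α) (hα1 : α ≤ 1) (C1 C2 : ℝ) (hC1 : 1 < C1) (hC12 : C1 < C2) :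
    ∃ c > (0 : ℝ), ∃ C > (0 : ℝ), ∀ N M : ℕ, 2 ≤ N → 2 ≤ M →
      C1 * N ≤ M → (M : ℝ) ≤ C2 * N →
      ∀ X : ℕ, 2 ≤ X → X ≤ M → X ≤ N →
        ‖(∑ n ∈ Finset.Icc 1 N,
              riemannZeta ((σ : ℂ) + 2 * (Real.pi : ℂ) * Complex.I * (d : ℂ) * (n : ℂ)) *
                Complex.exp (2 * (Real.pi : ℂ) * Complex.I * (θ : ℂ) * (n : ℂ)) /
                  ((((n : ℝ) ^ (1 - σ) : ℝ)) : ℂ))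
            - (Complex.exp (2 * (Real.pi : ℂ) * Complex.I / 8) *
                  (((d ^ ((1 : ℝ) / 2 - σ) : ℝ)) : ℂ)) *
                ∑ m ∈ Finset.Icc 1 M, (1 / ((((m : ℝ) ^ (1 - σ) : ℝ)) : ℂ)) *
                  ∑ h ∈ Finset.Icc (-⌊c * (Real.log ((M : ℝ) * N)) ^ (1 + α)⌋)
                      ⌊c * (Real.log ((M : ℝ) * N)) ^ (1 + α)⌋,
                    ∫ x in (X : ℝ)..(N : ℝ),
                      Complex.exp (2 * (Real.pi : ℂ) * Complex.I *
                          ((Fm d θ m x - (h : ℝ) * x : ℝ) : ℂ)) / ((Real.sqrt x : ℝ) : ℂ)‖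
          ≤ C * (1 + Real.sqrt X * Real.log (c * (Real.log ((M : ℝ) * N)) ^ (1 + α))
              + (if σ = 0 then 1 else 0) *
                  ((Real.log N) ^ (1 - α) + Real.sqrt X * (Real.log X) ^ ((2 : ℝ) / 3) *
                    Real.log (c * (Real.log ((M : ℝ) * N)) ^ (1 + α)))) := by
  have hC2 : 1 < C2 := hC1.trans hC12
  have hκ : 1 ≤ 1 - σ := by linarith
  set c := max (2 * (d * (1 + |Real.log d|) + |θ|)) (Real.exp 1) with hc
  have hce : Real.exp 1 ≤ c := le_max_right _ _
  have hcL : 2 * (d * (1 + |Real.log d|) + |θ|) ≤ c := le_max_left _ _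
  have he1 : 1 ≤ Real.exp 1 := Real.one_le_exp zero_le_one
  have hc1 : 1 ≤ c := he1.trans hce
  obtain ⟨Q0, hQ0, hE0⟩ := errE0 θ hσ hd
  obtain ⟨Q1, hQ1, hE1⟩ := errE1 (κ := 1 - σ) θ hκ hd
  obtain ⟨Q2, hQ2, hE2⟩ := errE2 (κ := 1 - σ) θ hκ hd
  obtain ⟨Q3, hQ3, hE3⟩ := errE3 θ hσ hd hα0 hα1 hC2 hc1 hcL
  set D : ℂ := (Complex.exp (2 * (Real.pi : ℂ) * Complex.I / 8) * (((d ^ ((1 : ℝ) / 2 - σ) : ℝ)) : ℂ)) with hD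
  refine ⟨c, by linarith, Q0 + ‖D‖ * (Q1 + Q2 + Q3), by positivity, ?_⟩
  intro N M hN hM hCN hMC X hX hXM hXN
  have hN' : (2:ℝ) ≤ N := by exact_mod_cast hN
  have hX' : (2:ℝ) ≤ X := by exact_mod_cast hX
  have hNM : N ≤ M := by
    have : (N:ℝ) ≤ M := by nlinarith
    exact_mod_cast this
  have hM' : (N:ℝ) ≤ M := by exact_mod_cast hNM
  set H := c * (Real.log ((M : ℝ) * N)) ^ (1 + α) with hH
  have hl1 : 1 ≤ Real.log ((M:ℝ) * N) := by
    rw [Real.le_log_iff_exp_le (mul_pos (by linarith) (by linarith))]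
    have := Real.exp_one_lt_d9
    nlinarith
  have hHe : Real.exp 1 ≤ H := by
    have : 1 ≤ (Real.log ((M : ℝ) * N)) ^ (1 + α) := Real.one_le_rpow hl1 (by linarith)
    exact hce.trans (le_mul_of_one_le_right (by linarith) this)
  have hH0 : 0 ≤ H := by linarith
  have hlogH : 1 ≤ Real.log H := by
    rw [Real.le_log_iff_exp_le (by linarith)]; exact hHe
  obtain ⟨K, hK⟩ : ∃ K : ℕ, (K:ℤ) = ⌊H⌋ := ⟨⌊H⌋.toNat, Int.toNat_of_nonneg (Int.floor_nonneg.2 hH0)⟩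
  have hKH : H ≤ K + 1 := by
    have h1 := (Int.lt_floor_add_one H).le
    rw [← hK] at h1
    exact_mod_cast h1
  have hI : ∀ n : ℕ, Finset.Icc 1 n = Finset.Ioc 0 n := by
    intro n; ext; simp only [Finset.mem_Icc, Finset.mem_Ioc]; omega
  rw [hI, hI, ← hK]
  have hrhs : ∑ m ∈ Finset.Ioc 0 M, (1 / ((((m : ℝ) ^ (1 - σ) : ℝ)) : ℂ)) *
                  ∑ h ∈ Finset.Icc (-(K:ℤ)) K,
                    ∫ x in (X : ℝ)..(N : ℝ),
                      Complex.exp (2 * (Real.pi : ℂ) * Complex.I *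
                          ((Fm d θ m x - (h : ℝ) * x : ℝ) : ℂ)) / ((Real.sqrt x : ℝ) : ℂ)
      = ∑ m ∈ Finset.Ioc 0 M, (((m:ℝ) ^ (-(1 - σ)) : ℝ) : ℂ) * ∑ h ∈ Finset.Icc (-(K:ℤ)) K, Tint (1/2) (Fm d θ m) X N h := by
    apply Finset.sum_congr rfl; intro m _
    rw [Real.rpow_neg (by positivity), Complex.ofReal_inv, one_div]
    congr 1
    apply Finset.sum_congr rfl; intro h _
    exact integral_conv d θ m X N (by omega) hXN h
  rw [hrhs]
  have a0 := hE0 (Finset.Ioc 0 N) (fun n hn => (Finset.mem_Ioc.1 hn).1)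
  have a1 := hE1 X (by omega)
  have a2 := hE2 X N M (by omega) hXN hNM
  have a3 := hE3 X N M K (by omega) hN hXN hNM hMC hKH
  set Z := ∑ n ∈ Finset.Ioc 0 N,
              riemannZeta ((σ : ℂ) + 2 * (Real.pi : ℂ) * Complex.I * (d : ℂ) * (n : ℂ)) *
                Complex.exp (2 * (Real.pi : ℂ) * Complex.I * (θ : ℂ) * (n : ℂ)) /
                  ((((n : ℝ) ^ (1 - σ) : ℝ)) : ℂ) with hZ
  set W := ∑ m ∈ Finset.Ioc 0 M, (((m:ℝ) ^ (-(1 - σ)) : ℝ) : ℂ) * ∑ h ∈ Finset.Icc (-(K:ℤ)) K, Tint (1/2) (Fm d θ m) X N h with hW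
  have split : ∑ n ∈ Finset.Ioc 0 N, an d θ n * riemannZeta (wz (1 - σ) (d * n))
      = ∑ n ∈ Finset.Ioc 0 X, an d θ n * riemannZeta (wz (1 - σ) (d * n))
        + (∑ n ∈ Finset.Ioc X N, an d θ n * (riemannZeta (wz (1 - σ) (d * n)) - ∑ m ∈ Finset.Ioc 0 M, zt (1 - σ) (d * n) m)
          + ∑ n ∈ Finset.Ioc X N, an d θ n * ∑ m ∈ Finset.Ioc 0 M, zt (1 - σ) (d * n) m) := by
    rw [← Finset.sum_Ioc_consecutive _ (Nat.zero_le X) hXN, ← Finset.sum_add_distrib]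
    congr 1
    apply Finset.sum_congr rfl; intro n _; ring
  set S0 := ∑ n ∈ Finset.Ioc 0 N, an d θ n * riemannZeta (wz (1 - σ) (d * n))
  set S1 := ∑ n ∈ Finset.Ioc 0 X, an d θ n * riemannZeta (wz (1 - σ) (d * n))
  set S2 := ∑ n ∈ Finset.Ioc X N, an d θ n * (riemannZeta (wz (1 - σ) (d * n)) - ∑ m ∈ Finset.Ioc 0 M, zt (1 - σ) (d * n) m)
  set S3 := ∑ n ∈ Finset.Ioc X N, an d θ n * ∑ m ∈ Finset.Ioc 0 M, zt (1 - σ) (d * n) m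
  have eq : Z - D * W = (Z - D * S0) + D * (S1 + S2 + (S3 - W)) := by rw [split]; ring
  rw [eq]
  refine (norm_add_le _ _).trans ?_
  rw [norm_mul]
  have b := (norm_add₃_le (a := S1) (b := S2) (c := S3 - W))
  have hlN : 0 ≤ (Real.log N)^(1-α) := Real.rpow_nonneg (Real.log_nonneg (by linarith)) _
  have hlX : 0 ≤ (Real.log X)^((2:ℝ)/3) := Real.rpow_nonneg (Real.log_nonneg (by linarith)) _
  have hsX : 0 ≤ Real.sqrt X := Real.sqrt_nonneg _
  have hsl : Real.sqrt X ≤ Real.sqrt X * Real.log H := le_mul_of_one_le_right hsX hlogH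
  have hi : (0:ℝ) ≤ (if σ = 0 then (1:ℝ) else 0) := by split_ifs <;> norm_num
  set ι : ℝ := (if σ = 0 then (1:ℝ) else 0) with hι
  set R := 1 + Real.sqrt X * Real.log H + ι * ((Real.log N) ^ (1 - α) + Real.sqrt X * (Real.log X) ^ ((2 : ℝ) / 3) * Real.log H) with hR
  have hextra : 0 ≤ ι * (Real.sqrt X * (Real.log X) ^ ((2 : ℝ) / 3) * Real.log H) := by positivity
  have hextra2 : 0 ≤ ι * (Real.log N)^(1-α) := by positivity
  have hRe : R = 1 + Real.sqrt X * Real.log H + ι * (Real.log N) ^ (1 - α) + ι * (Real.sqrt X * (Real.log X) ^ ((2 : ℝ) / 3) * Real.log H) := by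
    rw [hR]; ring
  have r1 : 1 ≤ R := by linarith
  have r2 : Real.sqrt X ≤ R := by linarith
  have r3 : 1 + ι * (Real.log N)^(1-α) ≤ R := by linarith
  have hS : ‖S1 + S2 + (S3 - W)‖ ≤ (Q1 + Q2 + Q3) * R := by
    refine b.trans ?_
    calc _ ≤ Q1 * Real.sqrt X + Q2 + Q3 * (1 + ι * (Real.log N)^(1-α)) := by linarith
      _ ≤ Q1 * R + Q2 * R + Q3 * R := by
        gcongr
        exact le_mul_of_one_le_right hQ2.le r1
      _ = _ := by ring
  calc _ ≤ Q0 * R + ‖D‖ * ((Q1 + Q2 + Q3) * R) := by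
        gcongr
        exact a0.trans (le_mul_of_one_le_right hQ0.le r1)
    _ = _ := by ring
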